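/- Fix N ≥ 1, k > 1 and r ∈ ℕ; set K_N := [−N,N]^d and H := { μ ∈ M⁺(ℝ^d) : supp μ ⊆ K_N, μ(ℝ^d) ∈ [1/k,k] }. Let φ ∈ C²_b(K_Nʳ × [1/k,k]) be symmetric in its first r arguments and define f(μ) := μ(ℝ^d)^{−r} ∫_{(ℝ^d)ʳ} φ(x₁,…,x_r, μ(ℝ^d)) dμ^{⊗r}(x₁,…,x_r). Then there exists a sequence (fⁿ) of cylindrical functions of order 2, i.e. fⁿ(μ) = gₙ(⟨μ,ψ₁ⁿ⟩,…,⟨μ,ψ_{mₙ}ⁿ⟩) with mₙ ∈ ℕ, gₙ ∈ C²_b(ℝ^{mₙ}) and ψᵢⁿ ∈ C²_b(ℝ^d), such that sup_{μ∈H} |fⁿ(μ) − f(μ)| → 0 as n → ∞, and moreover the linear functional derivatives of fⁿ converge uniformly on H × K_N to a linear functional derivative of f, the second-order linear functional derivatives converge uniformly on H × K_N × K_N, and the corresponding spatial gradients (the L-derivatives D_μfⁿ, their spatial Jacobians, the spatial gradients of the second-order derivatives, and the second-order L-derivatives D²_μfⁿ) converge uniformly to those of f. -/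

import Mathlib

open MeasureTheory Set Filter Topology
open scoped NNReal ENNReal

noncomputable section

/-- `ℝ^d`. -/
abbrev Eu (d : ℕ) : Type := EuclideanSpace ℝ (Fin d)

/-- `M⁺(ℝ^d)`, the finite positive Borel measures on `ℝ^d`, with the weak topology. -/
abbrev Md (d : ℕ) : Type := MeasureTheory.FiniteMeasure (Eu d)

variable {d : ℕ}

/-- The segment `t μ' + (1 - t) μ` in the space of finite measures. -/
noncomputable def seg (μ μ' : Md d) (t : ℝ) : Md d :=
  t.toNNReal • μ' + (1 - t).toNNReal • μ

/-- `⟨μ, ψ⟩ = ∫ ψ dμ`. -/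
noncomputable def pairing (μ : Md d) (ψ : Eu d → ℝ) : ℝ :=
  ∫ x, ψ x ∂(μ : Measure (Eu d))

/-- `δu` is a linear functional derivative of `u : M⁺(ℝ^d) → ℝ`: it is bounded, jointly
continuous (weak topology on measures), and satisfies the fundamental identity. -/
def IsLFD (u : Md d → ℝ) (δu : Md d → Eu d → ℝ) : Prop :=
  (∃ C : ℝ, ∀ (μ : Md d) (x : Eu d), |δu μ x| ≤ C) ∧
  Continuous (fun p : Md d × Eu d => δu p.1 p.2) ∧
  ∀ μ μ' : Md d,
    u μ' - u μ =
      ∫ t in (0:ℝ)..1,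
        (pairing μ' (fun x => δu (seg μ μ' t) x) - pairing μ (fun x => δu (seg μ μ' t) x))

/-- The Dirac measure at `x` as a finite measure. -/
noncomputable def diracFM (x : Eu d) : Md d := ⟨Measure.dirac x, inferInstance⟩

/-- The compact rectangle `K_N = [−N,N]^d`. -/
def KN (d N : ℕ) : Set (Eu d) := {x : Eu d | ∀ i, |x i| ≤ (N : ℝ)}

/-- `H_N^k = {μ ∈ M⁺(ℝ^d) : supp μ ⊆ K_N, μ(ℝ^d) ∈ [1/k, k]}` (the support condition is
expressed as `μ(K_Nᶜ) = 0`, which is equivalent since `K_N` is closed). -/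
def HNk (d N : ℕ) (k : ℝ) : Set (Md d) :=
  {μ : Md d | (μ : Measure (Eu d)) (KN d N)ᶜ = 0 ∧
    1 / k ≤ (μ.mass : ℝ) ∧ (μ.mass : ℝ) ≤ k}

/-- The scaled empirical measure `(c/n) Σᵢ δ_{xᵢ}`. -/
noncomputable def empM {d : ℕ} (c : ℝ) (n : ℕ) (x : Fin n → Eu d) : Md d :=
  (c / (n : ℝ)).toNNReal • ∑ i : Fin n, diracFM (x i)

/-- `δu` is a linear functional derivative of `u` on a set `H` of measures (spatial
variable restricted to `K`): bounded and continuous on `H × K`, with the fundamental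
identity holding for measures in `H` (note that `H` is convex in our application, so the
segments stay in `H`). -/
def IsLFDOn (u : Md d → ℝ) (δu : Md d → Eu d → ℝ)
    (H : Set (Md d)) (K : Set (Eu d)) : Prop :=
  (∃ C : ℝ, ∀ μ ∈ H, ∀ x ∈ K, |δu μ x| ≤ C) ∧
  ContinuousOn (fun p : Md d × Eu d => δu p.1 p.2) (H ×ˢ K) ∧
  ∀ μ ∈ H, ∀ μ' ∈ H,
    u μ' - u μ =
      ∫ t in (0:ℝ)..1,
        (pairing μ' (fun x => δu (seg μ μ' t) x) - pairing μ (fun x => δu (seg μ μ' t) x))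

/-- `F` is a cylindrical function of order 2: `F(μ) = g(⟨μ,ψ₁⟩,…,⟨μ,ψ_m⟩)` with
`g ∈ C²_b(ℝ^m)` and `ψᵢ ∈ C²_b(ℝ^d)`. -/
def IsCylindrical2 {d : ℕ} (F : Md d → ℝ) : Prop :=
  ∃ (m : ℕ) (g : (Fin m → ℝ) → ℝ) (ψ : Fin m → Eu d → ℝ),
    ContDiff ℝ 2 g ∧
    (∃ C : ℝ, ∀ v, |g v| ≤ C) ∧
    (∃ C : ℝ, ∀ v, ‖fderiv ℝ g v‖ ≤ C) ∧
    (∃ C : ℝ, ∀ v, ‖fderiv ℝ (fderiv ℝ g) v‖ ≤ C) ∧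
    (∀ i, ContDiff ℝ 2 (ψ i)) ∧
    (∃ C : ℝ, ∀ i x, |ψ i x| ≤ C) ∧
    (∃ C : ℝ, ∀ i x, ‖fderiv ℝ (ψ i) x‖ ≤ C) ∧
    (∃ C : ℝ, ∀ i x, ‖fderiv ℝ (fderiv ℝ (ψ i)) x‖ ≤ C) ∧
    F = fun μ => g (fun i => pairing μ (ψ i))

/-! ### Finite measures, pairings and segments -/

lemma pairing_one (μ : Md d) : pairing μ (fun _ => 1) = (μ.mass : ℝ) := by
  simp only [pairing, integral_const, smul_eq_mul, mul_one]
  rfl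

lemma continuous_pairing {ψ : Eu d → ℝ} (hc : Continuous ψ) {C : ℝ} (hC : ∀ x, |ψ x| ≤ C) :
    Continuous fun μ : Md d => pairing μ ψ := by
  rw [continuous_iff_continuousAt]
  intro μ
  exact FiniteMeasure.tendsto_iff_forall_integral_tendsto.1 tendsto_id
    (BoundedContinuousFunction.ofNormedAddCommGroup ψ hc C hC)

lemma abs_pairing_le (μ : Md d) {ψ : Eu d → ℝ} {C : ℝ} (hC : ∀ x, |ψ x| ≤ C) :
    |pairing μ ψ| ≤ C * μ.mass := by
  exact norm_integral_le_of_norm_le_const (μ := (μ : Measure (Eu d))) (f := ψ) (ae_of_all _ hC)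

lemma pairing_seg (μ μ' : Md d) {t : ℝ} (ht : t ∈ Icc (0 : ℝ) 1) {ψ : Eu d → ℝ}
    (hc : Continuous ψ) {C : ℝ} (hC : ∀ x, |ψ x| ≤ C) :
    pairing (seg μ μ' t) ψ = pairing μ ψ + t * (pairing μ' ψ - pairing μ ψ) := by
  have h : ∀ ν : Md d, Integrable ψ (ν : Measure (Eu d)) := fun ν =>
    Integrable.of_bound hc.aestronglyMeasurable C (ae_of_all _ hC)
  unfold pairing seg
  rw [FiniteMeasure.toMeasure_add, integral_add_measure (h _) (h _),
    FiniteMeasure.toMeasure_smul, FiniteMeasure.toMeasure_smul,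
    integral_smul_nnreal_measure, integral_smul_nnreal_measure]
  simp only [NNReal.smul_def, smul_eq_mul, Real.coe_toNNReal _ ht.1,
    Real.coe_toNNReal (1 - t) (by linarith [ht.2])]
  ring

lemma mass_seg (μ μ' : Md d) {t : ℝ} (ht : t ∈ Icc (0 : ℝ) 1) :
    ((seg μ μ' t).mass : ℝ) = μ.mass + t * ((μ'.mass : ℝ) - μ.mass) := by
  have := pairing_seg μ μ' ht (ψ := fun _ => 1) continuous_const (C := 1) (by simp)
  simpa only [pairing_one] using this

lemma continuous_seg (μ μ' : Md d) : Continuous (seg μ μ') := by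
  unfold seg
  exact (continuous_real_toNNReal.smul continuous_const).add
    ((continuous_real_toNNReal.comp (continuous_const.sub continuous_id)).smul continuous_const)

lemma seg_mem_HNk {N : ℕ} {k : ℝ} {μ μ' : Md d} (hμ : μ ∈ HNk d N k) (hμ' : μ' ∈ HNk d N k)
    {t : ℝ} (ht : t ∈ Icc (0 : ℝ) 1) : seg μ μ' t ∈ HNk d N k := by
  obtain ⟨h0, h1, h2⟩ := hμ
  obtain ⟨h0', h1', h2'⟩ := hμ'
  refine ⟨?_, ?_, ?_⟩
  · unfold seg
    simp [FiniteMeasure.toMeasure_add, FiniteMeasure.toMeasure_smul, h0, h0']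
  · rw [mass_seg _ _ ht]; nlinarith [ht.1, ht.2]
  · rw [mass_seg _ _ ht]; nlinarith [ht.1, ht.2]

/-! ### Linear functional derivatives: linearity and passage to the limit -/

lemma IsLFD.integrable {u : Md d → ℝ} {v : Md d → Eu d → ℝ} (h : IsLFD u v) (ν μ : Md d) :
    Integrable (v ν) (μ : Measure (Eu d)) := by
  obtain ⟨⟨C, hC⟩, hc, -⟩ := h
  exact Integrable.of_bound
    (hc.comp (continuous_const.prodMk continuous_id)).aestronglyMeasurable C (ae_of_all _ (hC ν))

lemma IsLFD.continuous_pairing {u : Md d → ℝ} {v : Md d → Eu d → ℝ} (h : IsLFD u v)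
    (μ μ' ν : Md d) : Continuous fun t => pairing ν (fun x => v (seg μ μ' t) x) := by
  obtain ⟨⟨C, hC⟩, hc, -⟩ := h
  refine continuous_of_dominated (bound := fun _ => C) (fun t => ?_)
    (fun t => ae_of_all _ fun x => hC _ x) (integrable_const C) (ae_of_all _ fun x => ?_)
  · exact (hc.comp (continuous_const.prodMk continuous_id)).aestronglyMeasurable
  · exact hc.comp ((continuous_seg μ μ').prodMk continuous_const)

lemma IsLFD.add {u₁ u₂ : Md d → ℝ} {v₁ v₂ : Md d → Eu d → ℝ} (h₁ : IsLFD u₁ v₁)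
    (h₂ : IsLFD u₂ v₂) : IsLFD (fun μ => u₁ μ + u₂ μ) (fun μ x => v₁ μ x + v₂ μ x) := by
  have i₁ := h₁.integrable
  have i₂ := h₂.integrable
  have c₁ := h₁.continuous_pairing
  have c₂ := h₂.continuous_pairing
  obtain ⟨⟨C₁, hC₁⟩, hc₁, hi₁⟩ := h₁
  obtain ⟨⟨C₂, hC₂⟩, hc₂, hi₂⟩ := h₂
  refine ⟨⟨C₁ + C₂, fun μ x => (abs_add_le _ _).trans (add_le_add (hC₁ μ x) (hC₂ μ x))⟩,
    hc₁.add hc₂, fun μ μ' => ?_⟩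
  have : ∀ ν τ : Md d, pairing ν (fun x => v₁ τ x + v₂ τ x) =
      pairing ν (v₁ τ) + pairing ν (v₂ τ) := fun ν τ => integral_add (i₁ τ ν) (i₂ τ ν)
  have e : u₁ μ' + u₂ μ' - (u₁ μ + u₂ μ) = (u₁ μ' - u₁ μ) + (u₂ μ' - u₂ μ) := by ring
  have j₁ : IntervalIntegrable (fun t => pairing μ' (fun x => v₁ (seg μ μ' t) x) -
      pairing μ (fun x => v₁ (seg μ μ' t) x)) volume 0 1 :=
    ((c₁ μ μ' μ').sub (c₁ μ μ' μ)).intervalIntegrable _ _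
  have j₂ : IntervalIntegrable (fun t => pairing μ' (fun x => v₂ (seg μ μ' t) x) -
      pairing μ (fun x => v₂ (seg μ μ' t) x)) volume 0 1 :=
    ((c₂ μ μ' μ').sub (c₂ μ μ' μ)).intervalIntegrable _ _
  simp only [e, hi₁, hi₂]
  rw [← intervalIntegral.integral_add j₁ j₂]
  refine intervalIntegral.integral_congr fun t _ => ?_
  simp only [this]
  ring

lemma IsLFD.const_mul {u : Md d → ℝ} {v : Md d → Eu d → ℝ} (h : IsLFD u v) (a : ℝ) :
    IsLFD (fun μ => a * u μ) (fun μ x => a * v μ x) := by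
  obtain ⟨⟨C, hC⟩, hc, hi⟩ := h
  refine ⟨⟨|a| * C, fun μ x => ?_⟩, continuous_const.mul hc, fun μ μ' => ?_⟩
  · rw [abs_mul]; exact mul_le_mul_of_nonneg_left (hC μ x) (abs_nonneg a)
  · rw [← mul_sub, hi, ← intervalIntegral.integral_const_mul]
    refine intervalIntegral.integral_congr fun t _ => ?_
    simp only [pairing, integral_const_mul]
    ring

lemma isLFD_zero : IsLFD (fun _ : Md d => 0) (fun _ _ => 0) :=
  ⟨⟨0, by simp⟩, continuous_const, by simp [pairing]⟩

lemma ae_mem_KN {N : ℕ} {k : ℝ} {μ : Md d} (hμ : μ ∈ HNk d N k) :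
    ∀ᵐ x ∂(μ : Measure (Eu d)), x ∈ KN d N := by
  rw [ae_iff]; exact hμ.1

/-- Linear functional derivatives on `HNk` are stable under uniform convergence. -/
lemma isLFDOn_of_tendstoUniformlyOn {N : ℕ} {k : ℝ} {u : ℕ → Md d → ℝ}
    {v : ℕ → Md d → Eu d → ℝ} (h : ∀ n, IsLFD (u n) (v n)) {u' : Md d → ℝ}
    {v' : Md d → Eu d → ℝ}
    (hu : ∀ μ ∈ HNk d N k, Tendsto (fun n => u n μ) atTop (𝓝 (u' μ)))
    (hv : TendstoUniformlyOn (fun n (p : Md d × Eu d) => v n p.1 p.2)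
      (fun p => v' p.1 p.2) atTop (HNk d N k ×ˢ KN d N)) :
    IsLFDOn u' v' (HNk d N k) (KN d N) := by
  have hv1 := Metric.tendstoUniformlyOn_iff.1 hv 1 one_pos
  have hbd : ∃ C : ℝ, ∀ μ ∈ HNk d N k, ∀ x ∈ KN d N, |v' μ x| ≤ C := by
    obtain ⟨n, hn⟩ := hv1.exists
    obtain ⟨⟨C, hC⟩, -, -⟩ := h n
    refine ⟨1 + C, fun μ hμ x hx => ?_⟩
    have h1 := hn (μ, x) ⟨hμ, hx⟩
    rw [Real.dist_eq] at h1
    have h2 := hC μ x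
    have h3 := abs_sub_abs_le_abs_sub (v' μ x) (v n μ x)
    linarith
  refine ⟨hbd, hv.continuousOn (Frequently.of_forall fun n => (h n).2.1.continuousOn), ?_⟩
  intro μ hμ μ' hμ'
  obtain ⟨C, hC⟩ := hbd
  have hvn : ∀ᶠ n in atTop, ∀ μ ∈ HNk d N k, ∀ x ∈ KN d N, ‖v n μ x‖ ≤ C + 1 := by
    filter_upwards [hv1] with n hn μ hμ x hx
    have h1 := hn (μ, x) ⟨hμ, hx⟩
    rw [Real.dist_eq, abs_sub_comm] at h1
    have h3 := abs_sub_abs_le_abs_sub (v n μ x) (v' μ x)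
    have h2 := hC μ hμ x hx
    rw [Real.norm_eq_abs]
    linarith
  have hpair : ∀ ν ∈ HNk d N k, ∀ τ ∈ HNk d N k,
      Tendsto (fun n => pairing ν (v n τ)) atTop (𝓝 (pairing ν (v' τ))) := by
    intro ν hν τ hτ
    refine tendsto_integral_filter_of_dominated_convergence (fun _ => C + 1)
      (Eventually.of_forall fun n => ((h n).integrable τ ν).aestronglyMeasurable) ?_
      (integrable_const _) ?_
    · filter_upwards [hvn] with n hn
      filter_upwards [ae_mem_KN hν] with x hx using hn τ hτ x hx
    · filter_upwards [ae_mem_KN hν] with x hx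
      exact hv.tendsto_at (x := (τ, x)) ⟨hτ, hx⟩
  have hIoc : ∀ t ∈ uIoc (0 : ℝ) 1, seg μ μ' t ∈ HNk d N k := by
    intro t ht
    rw [uIoc_of_le zero_le_one] at ht
    exact seg_mem_HNk hμ hμ' ⟨ht.1.le, ht.2⟩
  have hpb : ∀ᶠ n in atTop, ∀ ν ∈ HNk d N k, ∀ τ ∈ HNk d N k,
      ‖pairing ν (v n τ)‖ ≤ (C + 1) * ν.mass := by
    filter_upwards [hvn] with n hn ν hν τ hτ
    exact norm_integral_le_of_norm_le_const (μ := (ν : Measure (Eu d))) (f := v n τ)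
      (C := C + 1) (by filter_upwards [ae_mem_KN hν] with x hx using hn τ hτ x hx)
  have hlim : Tendsto (fun n => ∫ t in (0:ℝ)..1, (pairing μ' (fun x => v n (seg μ μ' t) x) -
      pairing μ (fun x => v n (seg μ μ' t) x))) atTop
      (𝓝 (∫ t in (0:ℝ)..1, (pairing μ' (fun x => v' (seg μ μ' t) x) -
      pairing μ (fun x => v' (seg μ μ' t) x)))) := by
    refine intervalIntegral.tendsto_integral_filter_of_dominated_convergence
      (fun _ => (C + 1) * μ'.mass + (C + 1) * μ.mass)
      (Eventually.of_forall fun n => (((h n).continuous_pairing μ μ' μ').sub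
        ((h n).continuous_pairing μ μ' μ)).aestronglyMeasurable) ?_ (by simp) ?_
    · filter_upwards [hpb] with n hn
      refine ae_of_all _ fun t ht => (norm_sub_le _ _).trans ?_
      exact add_le_add (hn μ' hμ' _ (hIoc t ht)) (hn μ hμ _ (hIoc t ht))
    · exact ae_of_all _ fun t ht =>
        (hpair μ' hμ' _ (hIoc t ht)).sub (hpair μ hμ _ (hIoc t ht))
  refine tendsto_nhds_unique ?_ hlim
  refine ((hu μ' hμ').sub (hu μ hμ)).congr fun n => ?_
  exact (h n).2.2 μ μ'

/-! ### Statistics of order `r` and their kernels -/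

/-- The phase space `(ℝ^d)^r × ℝ` of the kernels `Ψ(x₁,…,x_r,z)`. -/
abbrev Ph (d r : ℕ) : Type := (Fin r → Eu d) × ℝ

variable {r : ℕ}

/-- The inclusion of the `i`-th spatial coordinate. -/
def insAt (i : Fin r) : Eu d →L[ℝ] Ph d r :=
  (ContinuousLinearMap.inl ℝ (Fin r → Eu d) ℝ).comp
    (ContinuousLinearMap.single ℝ (fun _ => Eu d) i)

/-- The map replacing the `i`-th spatial coordinate by `0`. -/
def delAt (i : Fin r) : Ph d r →L[ℝ] Ph d r :=
  ContinuousLinearMap.id ℝ (Ph d r) - (insAt i).comp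
    ((ContinuousLinearMap.proj i).comp (ContinuousLinearMap.fst ℝ (Fin r → Eu d) ℝ))

lemma delAt_add_insAt (i : Fin r) (p : Ph d r) (x : Eu d) :
    delAt i p + insAt i x = (Function.update p.1 i x, p.2) := by
  ext j
  · by_cases h : j = i
    · subst h; simp [delAt, insAt]
    · simp [delAt, insAt, h]
  · simp [delAt, insAt]

/-- The functional `μ ↦ ∫ Ψ(x₁,…,x_r,μ(ℝ^d)) dμ^{⊗r}`. -/
def lift {V : Type*} [NormedAddCommGroup V] [NormedSpace ℝ V] (Ψ : Ph d r → V) (μ : Md d) : V :=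
  ∫ w : Fin r → Eu d, Ψ (w, μ.mass) ∂(Measure.pi fun _ : Fin r => (μ : Measure (Eu d)))

/-- The kernel of the linear functional derivative of `lift Ψ` at the point `x`. -/
def kd (Ψ : Ph d r → ℝ) (x : Eu d) (p : Ph d r) : ℝ :=
  fderiv ℝ Ψ p (0, 1) + p.2⁻¹ * ∑ i, Ψ (delAt i p + insAt i x)

/-- Functions on `ℝ^d` of class `C²_b`. -/
def IsCb2 (ψ : Eu d → ℝ) : Prop :=
  ContDiff ℝ 2 ψ ∧ ∃ C : ℝ, (∀ x, |ψ x| ≤ C) ∧ (∀ x, ‖fderiv ℝ ψ x‖ ≤ C) ∧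
    ∀ x, ‖fderiv ℝ (fderiv ℝ ψ) x‖ ≤ C

/-- Smooth functions with compact support in `(0,∞)`. -/
def IsTest (c : ℝ → ℝ) : Prop :=
  ContDiff ℝ (⊤ : ℕ∞) c ∧ HasCompactSupport c ∧ tsupport c ⊆ Ioi 0

/-- The kernel `c(z) ∏ ψᵢ(xᵢ)`. -/
def prodFun (c : ℝ → ℝ) (ψ : Fin r → Eu d → ℝ) (p : Ph d r) : ℝ := c p.2 * ∏ i, ψ i (p.1 i)

/-- The kernels which are finite sums of products. -/
def sepKernels (d r : ℕ) : Submodule ℝ (Ph d r → ℝ) :=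
  Submodule.span ℝ {Ψ | ∃ (c : ℝ → ℝ) (ψ : Fin r → Eu d → ℝ),
    IsTest c ∧ (∀ i, IsCb2 (ψ i)) ∧ Ψ = prodFun c ψ}

lemma isCb2_const (a : ℝ) : IsCb2 (fun _ : Eu d => a) := by
  refine ⟨contDiff_const, |a|, by simp, by simp, fun x => ?_⟩
  have : fderiv ℝ (fun _ : Eu d => a) = fun _ => 0 := by ext1 y; simp
  rw [this, fderiv_fun_const]
  exact (norm_zero (E := Eu d →L[ℝ] Eu d →L[ℝ] ℝ)).le.trans (abs_nonneg a)

lemma exists_bound_of_hasCompactSupport {X F : Type*} [TopologicalSpace X]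
    [NormedAddCommGroup F] {u : X → F} (h : Continuous u) (hs : HasCompactSupport u) :
    ∃ C, ∀ x, ‖u x‖ ≤ C :=
  h.bounded_above_of_compact_support hs

lemma exists_jet_bound_of_hasCompactSupport {E : Type*} [NormedAddCommGroup E] [NormedSpace ℝ E]
    {ψ : E → ℝ} (h : ContDiff ℝ 2 ψ) (hs : HasCompactSupport ψ) :
    ∃ C : ℝ, (∀ x, |ψ x| ≤ C) ∧ (∀ x, ‖fderiv ℝ ψ x‖ ≤ C) ∧
      ∀ x, ‖fderiv ℝ (fderiv ℝ ψ) x‖ ≤ C := by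
  have h1 : ContDiff ℝ 1 (fderiv ℝ ψ) := h.fderiv_right (by norm_num)
  have h2 : Continuous (fderiv ℝ (fderiv ℝ ψ)) := h1.continuous_fderiv (by norm_num)
  have s1 : HasCompactSupport (fderiv ℝ ψ) := hs.fderiv ℝ
  have s2 : HasCompactSupport (fderiv ℝ (fderiv ℝ ψ)) := s1.fderiv ℝ
  obtain ⟨C0, hC0⟩ := exists_bound_of_hasCompactSupport h.continuous hs
  obtain ⟨C1, hC1⟩ := exists_bound_of_hasCompactSupport h1.continuous s1
  have h3 : ∃ C, ∀ x, ‖fderiv ℝ (fderiv ℝ ψ) x‖ ≤ C :=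
    @exists_bound_of_hasCompactSupport _ (E →L[ℝ] E →L[ℝ] ℝ) _ _ (fderiv ℝ (fderiv ℝ ψ)) h2 s2
  obtain ⟨C2, hC2⟩ := h3
  exact ⟨max C0 (max C1 C2), fun x => (hC0 x).trans (le_max_left _ _),
    fun x => (hC1 x).trans ((le_max_left _ _).trans (le_max_right _ _)),
    fun x => (hC2 x).trans ((le_max_right _ _).trans (le_max_right _ _))⟩

lemma isCb2_of_hasCompactSupport {ψ : Eu d → ℝ} (h : ContDiff ℝ 2 ψ)
    (hs : HasCompactSupport ψ) : IsCb2 ψ :=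
  ⟨h, exists_jet_bound_of_hasCompactSupport h hs⟩

lemma IsTest.eq_zero {c : ℝ → ℝ} (h : IsTest c) {z : ℝ} (hz : z ≤ 0) : c z = 0 := by
  by_contra hne
  exact absurd (h.2.2 (subset_tsupport _ hne)) (by simpa using hz)

lemma IsTest.deriv {c : ℝ → ℝ} (h : IsTest c) : IsTest (deriv c) :=
  ⟨(contDiff_infty_iff_deriv.1 h.1).2, h.2.1.deriv, tsupport_deriv_subset.trans h.2.2⟩

lemma IsTest.inv_mul {c : ℝ → ℝ} (h : IsTest c) : IsTest (fun z => z⁻¹ * c z) := by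
  have hsub : tsupport (fun z => z⁻¹ * c z) ⊆ tsupport c :=
    closure_mono fun z hz => by
      rw [Function.mem_support] at hz ⊢; exact right_ne_zero_of_mul hz
  refine ⟨?_, HasCompactSupport.mul_left h.2.1, hsub.trans h.2.2⟩
  rw [contDiff_iff_contDiffAt]
  intro z
  by_cases hz : z ∈ tsupport c
  · exact (contDiffAt_inv ℝ (ne_of_gt (h.2.2 hz))).mul h.1.contDiffAt
  · have : (fun z => z⁻¹ * c z) =ᶠ[𝓝 z] fun _ => 0 := by
      filter_upwards [notMem_tsupport_iff_eventuallyEq.1 hz] with y hy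
      simp [hy]
    exact contDiffAt_const.congr_of_eventuallyEq this

lemma prodFun_mem {c : ℝ → ℝ} {ψ : Fin r → Eu d → ℝ} (hc : IsTest c) (hψ : ∀ i, IsCb2 (ψ i)) :
    prodFun c ψ ∈ sepKernels d r :=
  Submodule.subset_span ⟨c, ψ, hc, hψ, rfl⟩

lemma contDiff_prodFun {c : ℝ → ℝ} {ψ : Fin r → Eu d → ℝ} (hc : IsTest c)
    (hψ : ∀ i, IsCb2 (ψ i)) : ContDiff ℝ 2 (prodFun c ψ) := by
  refine ContDiff.mul ((hc.1.of_le (by norm_cast)).comp contDiff_snd) ?_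
  refine contDiff_prod fun i _ => (hψ i).1.comp ?_
  exact (contDiff_apply ℝ (Eu d) i).comp contDiff_fst

lemma contDiff_of_mem_sepKernels {Ψ : Ph d r → ℝ} (h : Ψ ∈ sepKernels d r) :
    ContDiff ℝ 2 Ψ := by
  induction h using Submodule.span_induction with
  | mem Ψ hΨ => obtain ⟨c, ψ, hc, hψ, rfl⟩ := hΨ; exact contDiff_prodFun hc hψ
  | zero => exact contDiff_const
  | add _ _ _ _ h1 h2 => exact h1.add h2
  | smul a _ _ h => exact contDiff_const.smul h

lemma exists_forall_IsCb2_le {ψ : Fin r → Eu d → ℝ} (hψ : ∀ i, IsCb2 (ψ i)) :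
    ∃ C : ℝ, 0 ≤ C ∧ ∀ i x, |ψ i x| ≤ C := by
  choose C hC _ using fun i => (hψ i).2
  refine ⟨∑ i, |C i|, by positivity, fun i x => ((hC i x).trans (le_abs_self _)).trans ?_⟩
  exact Finset.single_le_sum (f := fun i => |C i|) (fun _ _ => abs_nonneg _) (Finset.mem_univ i)

lemma bounded_of_mem_sepKernels {Ψ : Ph d r → ℝ} (h : Ψ ∈ sepKernels d r) :
    ∃ C : ℝ, ∀ p, |Ψ p| ≤ C := by
  induction h using Submodule.span_induction with
  | mem Ψ hΨ =>
    obtain ⟨c, ψ, hc, hψ, rfl⟩ := hΨ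
    obtain ⟨B, hB⟩ := hc.1.continuous.bounded_above_of_compact_support hc.2.1
    obtain ⟨C, hC0, hC⟩ := exists_forall_IsCb2_le hψ
    refine ⟨B * ∏ _i : Fin r, C, fun p => ?_⟩
    unfold prodFun
    rw [abs_mul, Finset.abs_prod]
    exact mul_le_mul (hB _) (Finset.prod_le_prod (fun _ _ => abs_nonneg _) fun i _ => hC i _)
      (Finset.prod_nonneg fun _ _ => abs_nonneg _) ((norm_nonneg _).trans (hB p.2))
  | zero => exact ⟨0, by simp⟩
  | add x y _ _ h1 h2 =>
    obtain ⟨C1, h1⟩ := h1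
    obtain ⟨C2, h2⟩ := h2
    exact ⟨C1 + C2, fun p => (abs_add_le _ _).trans (add_le_add (h1 p) (h2 p))⟩
  | smul a x _ h =>
    obtain ⟨C, h⟩ := h
    refine ⟨|a| * C, fun p => ?_⟩
    rw [Pi.smul_apply, smul_eq_mul, abs_mul]
    exact mul_le_mul_of_nonneg_left (h p) (abs_nonneg a)

lemma integrable_of_mem_sepKernels {Ψ : Ph d r → ℝ} (h : Ψ ∈ sepKernels d r) (μ : Md d) :
    Integrable (fun w => Ψ (w, (μ.mass : ℝ)))
      (Measure.pi fun _ : Fin r => (μ : Measure (Eu d))) := by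
  obtain ⟨C, hC⟩ := bounded_of_mem_sepKernels h
  exact Integrable.of_bound ((contDiff_of_mem_sepKernels h).continuous.comp
    (continuous_id.prodMk continuous_const)).aestronglyMeasurable C (ae_of_all _ fun w => hC _)

lemma lift_add {Ψ₁ Ψ₂ : Ph d r → ℝ} (h₁ : Ψ₁ ∈ sepKernels d r) (h₂ : Ψ₂ ∈ sepKernels d r)
    (μ : Md d) : lift (Ψ₁ + Ψ₂) μ = lift Ψ₁ μ + lift Ψ₂ μ :=
  integral_add (integrable_of_mem_sepKernels h₁ μ) (integrable_of_mem_sepKernels h₂ μ)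

lemma lift_smul (a : ℝ) (Ψ : Ph d r → ℝ) (μ : Md d) : lift (a • Ψ) μ = a * lift Ψ μ :=
  integral_const_mul _ _

lemma lift_zero (μ : Md d) : lift (0 : Ph d r → ℝ) μ = 0 := by simp [lift]

lemma lift_sum {ι : Type*} (s : Finset ι) {Ψ : ι → Ph d r → ℝ}
    (h : ∀ i, Ψ i ∈ sepKernels d r) (μ : Md d) :
    lift (∑ i ∈ s, Ψ i) μ = ∑ i ∈ s, lift (Ψ i) μ := by
  classical
  induction s using Finset.induction_on with
  | empty => simp [lift_zero]
  | insert a s ha ih =>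
    rw [Finset.sum_insert ha, Finset.sum_insert ha,
      lift_add (h a) (Submodule.sum_mem _ fun i _ => h i), ih]

lemma lift_prodFun (c : ℝ → ℝ) (ψ : Fin r → Eu d → ℝ) (μ : Md d) :
    lift (prodFun c ψ) μ = c μ.mass * ∏ i, pairing μ (ψ i) := by
  simp only [lift, prodFun, pairing]
  rw [integral_const_mul, integral_fintype_prod_eq_prod (fun i => ψ i)]

lemma kd_add {Ψ₁ Ψ₂ : Ph d r → ℝ} (h₁ : Ψ₁ ∈ sepKernels d r) (h₂ : Ψ₂ ∈ sepKernels d r)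
    (x : Eu d) : kd (Ψ₁ + Ψ₂) x = kd Ψ₁ x + kd Ψ₂ x := by
  funext p
  have e : fderiv ℝ (Ψ₁ + Ψ₂) p = fderiv ℝ Ψ₁ p + fderiv ℝ Ψ₂ p :=
    fderiv_add ((contDiff_of_mem_sepKernels h₁).differentiable (by norm_num) p)
      ((contDiff_of_mem_sepKernels h₂).differentiable (by norm_num) p)
  simp only [kd, e, Pi.add_apply, Finset.sum_add_distrib, add_apply]
  ring

lemma kd_smul (a : ℝ) {Ψ : Ph d r → ℝ} (h : Ψ ∈ sepKernels d r)
    (x : Eu d) : kd (a • Ψ) x = a • kd Ψ x := by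
  funext p
  have e : fderiv ℝ (a • Ψ) p = a • fderiv ℝ Ψ p :=
    fderiv_const_smul ((contDiff_of_mem_sepKernels h).differentiable (by norm_num) p) a
  simp only [kd, e, Pi.smul_apply, smul_eq_mul, ← Finset.mul_sum,
    smul_apply]
  ring

lemma kd_zero (x : Eu d) : kd (0 : Ph d r → ℝ) x = 0 := by
  funext p
  simp [kd]

lemma kd_prodFun {c : ℝ → ℝ} {ψ : Fin r → Eu d → ℝ} (hc : IsTest c) (hψ : ∀ i, IsCb2 (ψ i))
    (x : Eu d) :
    kd (prodFun c ψ) x = prodFun (deriv c) ψ +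
      ∑ i, ψ i x • prodFun (fun z => z⁻¹ * c z) (Function.update ψ i fun _ => 1) := by
  funext p
  have hd : DifferentiableAt ℝ (prodFun c ψ) p :=
    (contDiff_prodFun hc hψ).differentiable (by norm_num) p
  have h1 : fderiv ℝ (prodFun c ψ) p (0, 1) = deriv c p.2 * ∏ i, ψ i (p.1 i) := by
    have hl : HasDerivAt (fun t : ℝ => ((p.1, t) : Ph d r)) (0, 1) p.2 :=
      (hasDerivAt_const _ _).prodMk (hasDerivAt_id _)
    have h2 := HasFDerivAt.comp_hasDerivAt (f := fun t : ℝ => ((p.1, t) : Ph d r)) p.2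
      (l := prodFun c ψ) hd.hasFDerivAt hl
    have h3 : HasDerivAt (fun t => c t * ∏ i, ψ i (p.1 i)) (deriv c p.2 * ∏ i, ψ i (p.1 i)) p.2 :=
      ((hc.1.differentiable (by simp) _).hasDerivAt).mul_const _
    exact h2.unique h3
  simp only [kd, h1, Pi.add_apply, Finset.sum_apply, Pi.smul_apply, smul_eq_mul, prodFun,
    delAt_add_insAt, Finset.mul_sum]
  congr 1
  refine Finset.sum_congr rfl fun i _ => ?_
  have e1 : ∏ l, ψ l (Function.update p.1 i x l) =
      ψ i x * ∏ l ∈ Finset.univ.erase i, ψ l (p.1 l) := by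
    rw [← Finset.mul_prod_erase _ _ (Finset.mem_univ i)]
    congr 1
    · simp
    · refine Finset.prod_congr rfl fun l hl => ?_
      rw [Function.update_of_ne (Finset.ne_of_mem_erase hl)]
  have e2 : ∏ l, (Function.update ψ i (fun _ => 1) : Fin r → Eu d → ℝ) l (p.1 l) =
      ∏ l ∈ Finset.univ.erase i, ψ l (p.1 l) := by
    rw [← Finset.mul_prod_erase _ _ (Finset.mem_univ i)]
    simp only [Function.update_self, one_mul]
    refine Finset.prod_congr rfl fun l hl => ?_
    rw [Function.update_of_ne (Finset.ne_of_mem_erase hl)]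
  rw [e1, e2]
  ring

lemma isCb2_update_one {ψ : Fin r → Eu d → ℝ} (hψ : ∀ i, IsCb2 (ψ i)) (i j : Fin r) :
    IsCb2 ((Function.update ψ i fun _ => 1 : Fin r → Eu d → ℝ) j) := by
  by_cases h : j = i
  · subst h; simpa using isCb2_const 1
  · rw [Function.update_of_ne h]; exact hψ j

lemma kd_mem_sepKernels {Ψ : Ph d r → ℝ} (h : Ψ ∈ sepKernels d r) (x : Eu d) :
    kd Ψ x ∈ sepKernels d r := by
  induction h using Submodule.span_induction with
  | mem Ψ hΨ =>
    obtain ⟨c, ψ, hc, hψ, rfl⟩ := hΨ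
    rw [kd_prodFun hc hψ]
    refine Submodule.add_mem _ (prodFun_mem hc.deriv hψ) (Submodule.sum_mem _ fun i _ => ?_)
    exact Submodule.smul_mem _ _ (prodFun_mem hc.inv_mul (isCb2_update_one hψ i))
  | zero => rw [kd_zero]; exact Submodule.zero_mem _
  | add _ _ h1 h2 i1 i2 => rw [kd_add h1 h2]; exact Submodule.add_mem _ i1 i2
  | smul a _ h i => rw [kd_smul a h]; exact Submodule.smul_mem _ a i

lemma lift_kd_prodFun {c : ℝ → ℝ} {ψ : Fin r → Eu d → ℝ} (hc : IsTest c)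
    (hψ : ∀ i, IsCb2 (ψ i)) (μ : Md d) (x : Eu d) :
    lift (kd (prodFun c ψ) x) μ = deriv c μ.mass * ∏ i, pairing μ (ψ i) +
      ∑ i, ψ i x * (c μ.mass * ∏ l ∈ Finset.univ.erase i, pairing μ (ψ l)) := by
  have hm : ∀ i, prodFun (fun z => z⁻¹ * c z) (Function.update ψ i fun _ => 1) ∈
      sepKernels d r := fun i => prodFun_mem hc.inv_mul (isCb2_update_one hψ i)
  rw [kd_prodFun hc hψ, lift_add (prodFun_mem hc.deriv hψ)
    (Submodule.sum_mem _ fun i _ => Submodule.smul_mem _ _ (hm i)),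
    lift_sum _ (fun i => Submodule.smul_mem _ _ (hm i)), lift_prodFun]
  congr 1
  refine Finset.sum_congr rfl fun i _ => ?_
  rw [lift_smul, lift_prodFun, ← Finset.mul_prod_erase _ _ (Finset.mem_univ i)]
  simp only [Function.update_self, pairing_one]
  have e : ∏ l ∈ Finset.univ.erase i,
      pairing μ ((Function.update ψ i fun _ => 1 : Fin r → Eu d → ℝ) l) =
      ∏ l ∈ Finset.univ.erase i, pairing μ (ψ l) :=
    Finset.prod_congr rfl fun l hl => by
      rw [Function.update_of_ne (Finset.ne_of_mem_erase hl)]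
  rw [e]
  by_cases hz : (μ.mass : ℝ) = 0
  · simp [hz, hc.eq_zero le_rfl]
  · field_simp

lemma isLFD_lift_prodFun {c : ℝ → ℝ} {ψ : Fin r → Eu d → ℝ} (hc : IsTest c)
    (hψ : ∀ i, IsCb2 (ψ i)) :
    IsLFD (lift (prodFun c ψ)) (fun μ x => lift (kd (prodFun c ψ) x) μ) := by
  obtain ⟨C, hC0, hC⟩ := exists_forall_IsCb2_le hψ
  have hψc : ∀ i, Continuous (ψ i) := fun i => (hψ i).1.continuous
  have hcc : Continuous c := hc.1.continuous
  have hdc : Continuous (deriv c) := hc.deriv.1.continuous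
  have hpc : ∀ i, Continuous fun μ : Md d => pairing μ (ψ i) := fun i =>
    continuous_pairing (hψc i) (hC i)
  have hmc : Continuous fun μ : Md d => (μ.mass : ℝ) :=
    NNReal.continuous_coe.comp FiniteMeasure.continuous_mass
  have hbound : ∀ (c : ℝ → ℝ), IsTest c → ∀ s : Finset (Fin r), ∃ B : ℝ, ∀ μ : Md d,
      |c μ.mass * ∏ l ∈ s, pairing μ (ψ l)| ≤ B := by
    intro c hc s
    have hsupp : HasCompactSupport (fun z => c z * ∏ _l ∈ s, (C * z)) :=
      HasCompactSupport.mul_right hc.2.1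
    have hcont : Continuous (fun z => c z * ∏ _l ∈ s, (C * z)) := by
      have := hc.1.continuous
      fun_prop
    obtain ⟨B, hB⟩ := hcont.bounded_above_of_compact_support hsupp
    refine ⟨B, fun μ => le_trans ?_ (hB μ.mass)⟩
    rw [Real.norm_eq_abs, abs_mul, abs_mul, Finset.abs_prod, Finset.abs_prod]
    refine mul_le_mul_of_nonneg_left (Finset.prod_le_prod (fun _ _ => abs_nonneg _)
      fun i _ => ?_) (abs_nonneg _)
    exact (abs_pairing_le μ (hC i)).trans (le_abs_self _)
  refine ⟨?_, ?_, ?_⟩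
  · obtain ⟨B0, hB0⟩ := hbound _ hc.deriv Finset.univ
    choose B hB using fun i => hbound _ hc (Finset.univ.erase i)
    refine ⟨B0 + ∑ i, C * B i, fun μ x => ?_⟩
    simp only [lift_kd_prodFun hc hψ]
    refine (abs_add_le _ _).trans (add_le_add (hB0 μ) ?_)
    refine (Finset.abs_sum_le_sum_abs _ _).trans (Finset.sum_le_sum fun i _ => ?_)
    rw [abs_mul]
    exact mul_le_mul (hC i x) (hB i μ) (abs_nonneg _) hC0
  · simp only [lift_kd_prodFun hc hψ]
    fun_prop
  · intro μ μ'
    have hline : ∀ a b : ℝ, ∀ t : ℝ, HasDerivAt (fun t => a + t * (b - a)) (b - a) t := by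
      intro a b t
      simpa using ((hasDerivAt_id t).mul_const (b - a)).const_add a
    set z : ℝ → ℝ := fun t => (μ.mass : ℝ) + t * ((μ'.mass : ℝ) - μ.mass) with hz
    set a : Fin r → ℝ → ℝ := fun i t =>
      pairing μ (ψ i) + t * (pairing μ' (ψ i) - pairing μ (ψ i)) with ha
    have hzc : Continuous z := by fun_prop
    have hac : ∀ i, Continuous (a i) := fun i => by fun_prop
    set D : ℝ → ℝ := fun t => deriv c (z t) * ((μ'.mass : ℝ) - μ.mass) * ∏ i, a i t +
      c (z t) * ∑ i, (∏ l ∈ Finset.univ.erase i, a l t) *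
        (pairing μ' (ψ i) - pairing μ (ψ i)) with hD
    have hDc : Continuous D := by fun_prop
    have hderiv : ∀ t, HasDerivAt (fun t => c (z t) * ∏ i, a i t) (D t) t := by
      intro t
      refine HasDerivAt.mul ?_ ?_
      · exact HasDerivAt.comp t (hc.1.differentiable (by simp) _).hasDerivAt (hline _ _ t)
      · have := HasDerivAt.fun_finsetProd (u := Finset.univ) (f := a) (x := t)
          (f' := fun i => pairing μ' (ψ i) - pairing μ (ψ i)) fun i _ => hline _ _ t
        simpa [smul_eq_mul] using this
    have hint := intervalIntegral.integral_eq_sub_of_hasDerivAt (a := 0) (b := 1)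
      (fun t _ => hderiv t) (hDc.intervalIntegrable _ _)
    have e0 : ∀ i, a i 0 = pairing μ (ψ i) := fun i => by simp [ha]
    have e1 : ∀ i, a i 1 = pairing μ' (ψ i) := fun i => by simp [ha]
    have e2 : z 0 = μ.mass := by simp [hz]
    have e3 : z 1 = μ'.mass := by simp [hz]
    simp only [e0, e1, e2, e3] at hint
    rw [lift_prodFun, lift_prodFun, ← hint]
    refine intervalIntegral.integral_congr fun t ht => ?_
    rw [uIcc_of_le zero_le_one] at ht
    have hi : ∀ (ν : Md d) i, Integrable (ψ i) (ν : Measure (Eu d)) := fun ν i =>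
      Integrable.of_bound (hψc i).aestronglyMeasurable C (ae_of_all _ (hC i))
    have key : ∀ ν : Md d, pairing ν (fun x => lift (kd (prodFun c ψ) x) (seg μ μ' t)) =
        ν.mass * (deriv c (z t) * ∏ i, a i t) +
        ∑ i, pairing ν (ψ i) * (c (z t) * ∏ l ∈ Finset.univ.erase i, a l t) := by
      intro ν
      simp only [lift_kd_prodFun hc hψ, mass_seg μ μ' ht,
        fun i => pairing_seg μ μ' ht (hψc i) (hC i)]
      have hreal : (ν : Measure (Eu d)).real univ = ν.mass := rfl
      rw [pairing, integral_add (integrable_const _)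
        (integrable_finsetSum _ fun i _ => (hi ν i).mul_const _),
        integral_finsetSum _ fun i _ => (hi ν i).mul_const _]
      simp only [integral_mul_const, integral_const, smul_eq_mul, hreal, mul_assoc]
      rfl
    simp only [key, hD]
    rw [Finset.mul_sum, add_sub_add_comm, ← Finset.sum_sub_distrib]
    congr 1
    · ring
    · exact Finset.sum_congr rfl fun i _ => by ring

lemma isLFD_lift {Ψ : Ph d r → ℝ} (h : Ψ ∈ sepKernels d r) :
    IsLFD (lift Ψ) (fun μ x => lift (kd Ψ x) μ) := by
  induction h using Submodule.span_induction with
  | mem Ψ hΨ => obtain ⟨c, ψ, hc, hψ, rfl⟩ := hΨ; exact isLFD_lift_prodFun hc hψ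
  | zero => simpa only [kd_zero, lift_zero, funext lift_zero] using isLFD_zero
  | add _ _ h1 h2 i1 i2 =>
    have := i1.add i2
    simp only [← lift_add h1 h2,
      ← fun μ x => lift_add (kd_mem_sepKernels h1 x) (kd_mem_sepKernels h2 x) μ,
      ← kd_add h1 h2] at this
    exact this
  | smul a _ h i =>
    have := i.const_mul a
    simp only [← lift_smul, ← kd_smul a h] at this
    exact this

/-! ### Lifts of sums of products are cylindrical -/

lemma IsTest.exists_bound {c : ℝ → ℝ} (h : IsTest c) : ∃ R : ℝ, ∀ z, R < z → c z = 0 := by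
  obtain ⟨R, hR⟩ := h.2.1.isCompact.isBounded.subset_closedBall 0
  refine ⟨R, fun z hz => ?_⟩
  by_contra hne
  have h1 := hR (subset_tsupport _ hne)
  rw [mem_closedBall_zero_iff, Real.norm_eq_abs] at h1
  exact absurd ((le_abs_self z).trans h1) (not_le.2 hz)

lemma exists_cylindrical_of_mem_sepKernels {Ψ : Ph d r → ℝ} (h : Ψ ∈ sepKernels d r) :
    ∃ (m : ℕ) (g : (Fin m → ℝ) → ℝ) (ψ : Fin m → Eu d → ℝ) (R : ℝ),
      ContDiff ℝ 2 g ∧ (∀ i, IsCb2 (ψ i)) ∧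
      (∀ μ, lift Ψ μ = g fun i => pairing μ (ψ i)) ∧
      ∀ μ : Md d, R < (μ.mass : ℝ) → lift Ψ μ = 0 := by
  induction h using Submodule.span_induction with
  | mem Ψ hΨ =>
    obtain ⟨c, ψ, hc, hψ, rfl⟩ := hΨ
    obtain ⟨R, hR⟩ := hc.exists_bound
    refine ⟨r + 1, fun v => c (v 0) * ∏ i : Fin r, v i.succ,
      Fin.cons (fun _ => 1) ψ, R, ?_, ?_, ?_, ?_⟩
    · refine ((hc.1.of_le (by norm_cast)).comp (contDiff_apply ℝ ℝ 0)).mul ?_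
      exact contDiff_prod fun i _ => contDiff_apply ℝ ℝ i.succ
    · intro i
      refine Fin.cases ?_ (fun j => ?_) i
      · exact isCb2_const 1
      · exact hψ j
    · intro μ
      simp only [lift_prodFun, Fin.cons_zero, Fin.cons_succ, pairing_one]
    · intro μ hμ
      rw [lift_prodFun, hR _ hμ, zero_mul]
  | zero =>
    exact ⟨0, fun _ => 0, Fin.elim0, 0, contDiff_const, fun i => i.elim0, lift_zero,
      fun μ _ => lift_zero μ⟩
  | add Ψ₁ Ψ₂ h₁ h₂ i₁ i₂ =>
    obtain ⟨m₁, g₁, ψ₁, R₁, hg₁, hψ₁, e₁, z₁⟩ := i₁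
    obtain ⟨m₂, g₂, ψ₂, R₂, hg₂, hψ₂, e₂, z₂⟩ := i₂
    refine ⟨m₁ + m₂, fun v => g₁ (fun i => v (Fin.castAdd m₂ i)) +
      g₂ (fun i => v (Fin.natAdd m₁ i)), Fin.append ψ₁ ψ₂, max R₁ R₂, ?_, ?_, ?_, ?_⟩
    · exact (hg₁.comp (contDiff_pi.2 fun i => contDiff_apply ℝ ℝ _)).add
        (hg₂.comp (contDiff_pi.2 fun i => contDiff_apply ℝ ℝ _))
    · intro i
      refine Fin.addCases (fun j => ?_) (fun j => ?_) i
      · rw [Fin.append_left]; exact hψ₁ j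
      · rw [Fin.append_right]; exact hψ₂ j
    · intro μ
      simp only [lift_add h₁ h₂, e₁, e₂, Fin.append_left, Fin.append_right]
    · intro μ hμ
      rw [lift_add h₁ h₂, z₁ μ ((le_max_left _ _).trans_lt hμ),
        z₂ μ ((le_max_right _ _).trans_lt hμ), add_zero]
  | smul a Ψ h i =>
    obtain ⟨m, g, ψ, R, hg, hψ, e, z⟩ := i
    exact ⟨m, fun v => a * g v, ψ, R, contDiff_const.mul hg, hψ,
      fun μ => by rw [lift_smul, e], fun μ hμ => by rw [lift_smul, z μ hμ, mul_zero]⟩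

lemma isCylindrical2_lift {Ψ : Ph d r → ℝ} (h : Ψ ∈ sepKernels d r) :
    IsCylindrical2 (lift Ψ) := by
  obtain ⟨m, g, ψ, R, hg, hψ, e, z⟩ := exists_cylindrical_of_mem_sepKernels h
  choose hψ2 C hC0 hC1 hC2 using hψ
  set B : ℝ := ∑ i, |C i| with hB
  have hCB : ∀ i, C i ≤ B := fun i => (le_abs_self _).trans
    (Finset.single_le_sum (f := fun i => |C i|) (fun _ _ => abs_nonneg _) (Finset.mem_univ i))
  have hB0 : 0 ≤ B := Finset.sum_nonneg fun _ _ => abs_nonneg _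
  let χ : ContDiffBump (0 : Fin m → ℝ) := ⟨B * |R| + 1, B * |R| + 2, by positivity, by linarith⟩
  obtain ⟨D, hD0, hD1, hD2⟩ := exists_jet_bound_of_hasCompactSupport
    (ψ := fun v => χ v * g v) (χ.contDiff.mul hg) χ.hasCompactSupport.mul_right
  refine ⟨m, fun v => χ v * g v, ψ, χ.contDiff.mul hg, ⟨D, hD0⟩, ⟨D, hD1⟩, ⟨D, hD2⟩, hψ2,
    ⟨B, fun i x => (hC0 i x).trans (hCB i)⟩, ⟨B, fun i x => (hC1 i x).trans (hCB i)⟩,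
    ⟨B, fun i x => (hC2 i x).trans (hCB i)⟩, funext fun μ => ?_⟩
  beta_reduce
  by_cases hμ : R < (μ.mass : ℝ)
  · rw [← e, z μ hμ, mul_zero]
  · rw [χ.one_of_mem_closedBall, one_mul, e]
    rw [mem_closedBall_zero_iff, pi_norm_le_iff_of_nonneg χ.rIn_pos.le]
    intro i
    have h1 := abs_pairing_le μ fun x => (hC0 i x).trans (hCB i)
    have h2 : (μ.mass : ℝ) ≤ |R| := (not_lt.1 hμ).trans (le_abs_self R)
    exact (h1.trans (mul_le_mul_of_nonneg_left h2 hB0)).trans (by simp [χ])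

/-! ### Density of sums of products -/

section Convolution

variable {G V : Type} [NormedAddCommGroup G] [MeasurableSpace G] [BorelSpace G]
  [NormedAddCommGroup V] [NormedSpace ℝ V]

lemma integrable_smul_comp_sub {ν : Measure G} [IsFiniteMeasureOnCompacts ν] {f : G → ℝ}
    (hf : Continuous f) (hfs : HasCompactSupport f) {J : G → V} (hJ : Continuous J) (p : G) :
    Integrable (fun t => f t • J (p - t)) ν :=
  Continuous.integrable_of_hasCompactSupport (by fun_prop) hfs.smul_right

lemma exists_sum_translates_approx (ν : Measure G) [IsFiniteMeasureOnCompacts ν] {f : G → ℝ}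
    (hf : Continuous f) (hfs : HasCompactSupport f) {δ : ℝ} (hδ : 0 < δ) :
    ∃ (s : Finset G) (a : G → ℝ), (∀ q ∈ s, q ∈ tsupport f) ∧
      ∀ (V : Type) [NormedAddCommGroup V] [NormedSpace ℝ V] [CompleteSpace V] (J : G → V), Continuous J →
      ∀ ε : ℝ, (∀ s t, dist s t < δ → dist (J s) (J t) ≤ ε) →
      ∀ p, dist (∫ t, f t • J (p - t) ∂ν) (∑ q ∈ s, a q • J (p - q)) ≤ ε * ∫ t, ‖f t‖ ∂ν := by
  by_cases hne : (tsupport f).Nonempty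
  swap
  · rw [not_nonempty_iff_eq_empty, tsupport_eq_empty_iff] at hne
    subst hne
    exact ⟨∅, 0, by simp, fun V _ _ _ J _ ε _ p => by simp⟩
  obtain ⟨T, hTs, hTf, hT⟩ := hfs.isCompact.finite_cover_balls hδ
  have hTne : T.Nonempty := by
    obtain ⟨x, hx⟩ := hne
    obtain ⟨y, hy, -⟩ := mem_iUnion₂.1 (hT hx)
    exact ⟨y, hy⟩
  obtain ⟨e, rfl⟩ := hTf.countable.exists_eq_range hTne
  have hN : ∃ N, ∀ y ∈ range e, ∃ k ≤ N, e k = y := by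
    choose! k hk using fun y (hy : y ∈ range e) => hy
    refine ⟨hTf.toFinset.sup k, fun y hy => ⟨k y, Finset.le_sup (hTf.mem_toFinset.2 hy), hk y hy⟩⟩
  obtain ⟨N, hN⟩ := hN
  set π := SimpleFunc.nearestPt e N with hπ
  have hπd : ∀ t ∈ tsupport f, dist (π t) t < δ := by
    intro t ht
    obtain ⟨y, hy, hty⟩ := mem_iUnion₂.1 (hT ht)
    obtain ⟨k, hk, rfl⟩ := hN y hy
    have h1 := SimpleFunc.edist_nearestPt_le e t hk
    rw [edist_dist, edist_dist, ENNReal.ofReal_le_ofReal_iff dist_nonneg] at h1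
    exact h1.trans_lt (by rwa [dist_comm])
  have hπr : ∀ q ∈ π.range, q ∈ tsupport f := by
    intro q hq
    obtain ⟨t, rfl⟩ := SimpleFunc.mem_range.1 hq
    have : ∀ n t, SimpleFunc.nearestPt e n t ∈ range e := by
      intro n t
      rw [SimpleFunc.nearestPt, SimpleFunc.map_apply]
      exact mem_range_self _
    exact hTs (this N t)
  have hfi : Integrable f ν := hf.integrable_of_hasCompactSupport hfs
  refine ⟨π.range, fun q => ∫ t in π ⁻¹' {q}, f t ∂ν, hπr, fun V _ _ _ J hJ ε hε p => ?_⟩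
  have hsum : ∀ t, f t • J (p - π t) =
      ∑ q ∈ π.range, ((π ⁻¹' {q}).indicator f t) • J (p - q) := by
    intro t
    rw [Finset.sum_eq_single_of_mem (π t) (SimpleFunc.mem_range_self π t)]
    · simp
    · intro q _ hq
      rw [indicator_of_notMem (by simpa using hq.symm), zero_smul]
  have hind : ∀ q, Integrable ((π ⁻¹' {q}).indicator f) ν := fun q =>
    hfi.indicator (π.measurableSet_fiber q)
  have hI : Integrable (fun t => f t • J (p - π t)) ν := by
    simp only [hsum]
    exact integrable_finsetSum _ fun q _ => (hind q).smul_const _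
  have hint : ∫ t, f t • J (p - π t) ∂ν =
      ∑ q ∈ π.range, (∫ t in π ⁻¹' {q}, f t ∂ν) • J (p - q) := by
    simp only [hsum]
    rw [integral_finsetSum _ fun q _ => (hind q).smul_const _]
    refine Finset.sum_congr rfl fun q _ => ?_
    rw [integral_smul_const, integral_indicator (π.measurableSet_fiber q)]
  rw [← hint, dist_eq_norm, ← integral_sub (integrable_smul_comp_sub hf hfs hJ p) hI,
    mul_comm, ← integral_mul_const]
  refine norm_integral_le_of_norm_le (hfi.norm.mul_const ε) (ae_of_all _ fun t => ?_)
  rw [← smul_sub, norm_smul]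
  by_cases ht : t ∈ tsupport f
  · refine mul_le_mul_of_nonneg_left ?_ (norm_nonneg _)
    rw [← dist_eq_norm]
    refine hε _ _ ?_
    rw [dist_sub_left, dist_comm]
    exact hπd t ht
  · simp [image_eq_zero_of_notMem_tsupport ht]

lemma dist_integral_mollifier_le [CompleteSpace V] {ν : Measure G} [IsFiniteMeasureOnCompacts ν]
    {κ : G → ℝ}
    (hκ : Continuous κ) (hκs : HasCompactSupport κ) (hκ0 : ∀ t, 0 ≤ κ t) (hκ1 : ∫ t, κ t ∂ν = 1)
    {δ : ℝ} (hκδ : ∀ t, κ t ≠ 0 → ‖t‖ < δ) {J : G → V} (hJ : Continuous J) {ε : ℝ}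
    (hε : ∀ s t, dist s t < δ → dist (J s) (J t) ≤ ε) (p : G) :
    dist (∫ t, κ t • J (p - t) ∂ν) (J p) ≤ ε := by
  have hκi : Integrable κ ν := hκ.integrable_of_hasCompactSupport hκs
  have h1 : J p = ∫ t, κ t • J p ∂ν := by rw [integral_smul_const, hκ1, one_smul]
  have h2 : ε = ∫ t, κ t * ε ∂ν := by rw [integral_mul_const, hκ1, one_mul]
  rw [dist_eq_norm, h2]
  nth_rw 1 [h1]
  rw [← integral_sub (integrable_smul_comp_sub hκ hκs hJ p) (hκi.smul_const _)]
  refine norm_integral_le_of_norm_le (hκi.mul_const ε) (ae_of_all _ fun t => ?_)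
  rw [← smul_sub, norm_smul, Real.norm_of_nonneg (hκ0 t)]
  by_cases ht : κ t = 0
  · simp [ht]
  · refine mul_le_mul_of_nonneg_left ?_ (hκ0 t)
    rw [← dist_eq_norm]
    exact hε _ _ (by simpa [dist_eq_norm] using hκδ t ht)

lemma hasFDerivAt_integral_smul_comp_sub [NormedSpace ℝ G] [FiniteDimensional ℝ G]
    [CompleteSpace V] {ν : Measure G} [ν.IsAddHaarMeasure]
    {f : G → ℝ} (hf : Continuous f) {g : G → V} (hg : ContDiff ℝ 1 g)
    (hgs : HasCompactSupport g) (p : G) :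
    HasFDerivAt (fun p => ∫ t, f t • g (p - t) ∂ν) (∫ t, f t • fderiv ℝ g (p - t) ∂ν) p :=
  hgs.hasFDerivAt_convolution_right (μ := ν) (ContinuousLinearMap.lsmul ℝ ℝ)
    hf.locallyIntegrable hg p

end Convolution

section Mollification

variable {G V : Type} [NormedAddCommGroup G] [NormedSpace ℝ G] [NormedAddCommGroup V]
  [NormedSpace ℝ V]

lemma hasFDerivAt_sum_translates {κ : G → V} (hκ : Differentiable ℝ κ) (s : Finset G) (a : G → ℝ)
    (p : G) : HasFDerivAt (fun p => ∑ q ∈ s, a q • κ (p - q))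
      (∑ q ∈ s, a q • fderiv ℝ κ (p - q)) p :=
  HasFDerivAt.fun_sum fun q _ =>
    ((hκ (p - q)).hasFDerivAt.comp p ((hasFDerivAt_id p).sub_const q)).const_smul (a q)

lemma exists_delta_of_hasCompactSupport {X F : Type*} [PseudoMetricSpace X]
    [NormedAddCommGroup F] {J : X → F} (hJ : Continuous J) (hJs : HasCompactSupport J) {ε : ℝ}
    (hε : 0 < ε) :
    ∃ δ > 0, ∀ s t, dist s t < δ → dist (J s) (J t) ≤ ε := by
  obtain ⟨δ, h0, h⟩ :=
    Metric.uniformContinuous_iff.1 (hJs.uniformContinuous_of_continuous hJ) ε hε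
  exact ⟨δ, h0, fun s t hst => (h hst).le⟩

lemma exists_delta_jet_of_hasCompactSupport {ψ : G → ℝ} (h : ContDiff ℝ 2 ψ)
    (hs : HasCompactSupport ψ) {ε : ℝ} (hε : 0 < ε) :
    ∃ δ > 0, (∀ s t, dist s t < δ → dist (ψ s) (ψ t) ≤ ε) ∧
      (∀ s t, dist s t < δ → dist (fderiv ℝ ψ s) (fderiv ℝ ψ t) ≤ ε) ∧
      ∀ s t, dist s t < δ → dist (fderiv ℝ (fderiv ℝ ψ) s) (fderiv ℝ (fderiv ℝ ψ) t) ≤ ε := by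
  have h1 : ContDiff ℝ 1 (fderiv ℝ ψ) := h.fderiv_right (by norm_num)
  have h2 : Continuous (fderiv ℝ (fderiv ℝ ψ)) := h1.continuous_fderiv (by norm_num)
  have s1 : HasCompactSupport (fderiv ℝ ψ) := hs.fderiv ℝ
  have s2 : HasCompactSupport (fderiv ℝ (fderiv ℝ ψ)) := s1.fderiv ℝ
  obtain ⟨δ₀, h0, H0⟩ := exists_delta_of_hasCompactSupport h.continuous hs hε
  obtain ⟨δ₁, h1', H1⟩ := exists_delta_of_hasCompactSupport h1.continuous s1 hε
  obtain ⟨δ₂, h2', H2⟩ := (@Metric.uniformContinuous_iff G (G →L[ℝ] G →L[ℝ] ℝ) _ _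
    (fderiv ℝ (fderiv ℝ ψ))).1 (s2.uniformContinuous_of_continuous h2) ε hε
  refine ⟨min δ₀ (min δ₁ δ₂), lt_min h0 (lt_min h1' h2'), fun s t hst => H0 s t (hst.trans_le (by simp)),
    fun s t hst => H1 s t (hst.trans_le (by simp)), fun s t hst => (H2 (hst.trans_le (by simp))).le⟩

variable [FiniteDimensional ℝ G] [MeasurableSpace G] [BorelSpace G]

lemma exists_sum_translates_jet_approx (ν : Measure G) [ν.IsAddHaarMeasure] {Φ : G → ℝ}
    (hΦ : ContDiff ℝ 2 Φ) (hΦs : HasCompactSupport Φ) {ε : ℝ} (hε : 0 < ε) :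
    ∃ δ > 0, ∀ κ : G → ℝ, ContDiff ℝ 2 κ → HasCompactSupport κ → (∀ t, 0 ≤ κ t) →
      ∫ t, κ t ∂ν = 1 → (∀ t, κ t ≠ 0 → ‖t‖ < δ) →
      ∃ (s : Finset G) (a : G → ℝ), (∀ q ∈ s, q ∈ tsupport Φ) ∧ ∀ p,
        dist (∑ q ∈ s, a q • κ (p - q)) (Φ p) ≤ ε ∧
        dist (∑ q ∈ s, a q • fderiv ℝ κ (p - q)) (fderiv ℝ Φ p) ≤ ε ∧
        dist (∑ q ∈ s, a q • fderiv ℝ (fderiv ℝ κ) (p - q)) (fderiv ℝ (fderiv ℝ Φ) p) ≤ ε := by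
  obtain ⟨δ, hδ, H0, H1, H2⟩ := exists_delta_jet_of_hasCompactSupport hΦ hΦs (half_pos hε)
  refine ⟨δ, hδ, fun κ hκ hκs hκ0 hκ1 hκδ => ?_⟩
  set I : ℝ := ∫ t, ‖Φ t‖ ∂ν with hI
  have hI0 : 0 ≤ I := integral_nonneg fun _ => norm_nonneg _
  obtain ⟨δ', hδ', K0, K1, K2⟩ := exists_delta_jet_of_hasCompactSupport hκ hκs
    (show 0 < ε / 2 / (I + 1) by positivity)
  obtain ⟨s, a, hs, ha⟩ :=
    exists_sum_translates_approx ν hΦ.continuous hΦs hδ'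
  refine ⟨s, a, hs, fun p => ?_⟩
  have hle : ε / 2 / (I + 1) * I ≤ ε / 2 := by
    rw [div_mul_eq_mul_div]
    exact div_le_of_le_mul₀ (by positivity) (by positivity)
      (mul_le_mul_of_nonneg_left (by linarith) (by positivity))
  have hΦ1 : ContDiff ℝ 1 (fderiv ℝ Φ) := hΦ.fderiv_right (by norm_num)
  have hκ1' : ContDiff ℝ 1 (fderiv ℝ κ) := hκ.fderiv_right (by norm_num)
  have hΦ2 : Continuous (fderiv ℝ (fderiv ℝ Φ)) := hΦ1.continuous_fderiv (by norm_num)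
  have hκ2 : Continuous (fderiv ℝ (fderiv ℝ κ)) := hκ1'.continuous_fderiv (by norm_num)
  have e0 : ∀ p, ∫ t, Φ t • κ (p - t) ∂ν = ∫ t, κ t • Φ (p - t) ∂ν := by
    intro p
    rw [← integral_sub_left_eq_self _ ν p]
    refine integral_congr_ae (ae_of_all _ fun t => ?_)
    simp [mul_comm]
  have e1 : ∀ p, ∫ t, Φ t • fderiv ℝ κ (p - t) ∂ν = ∫ t, κ t • fderiv ℝ Φ (p - t) ∂ν := by
    intro p
    refine (hasFDerivAt_integral_smul_comp_sub hΦ.continuous (hκ.of_le (by norm_num)) hκs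
      p).unique ?_
    simp only [e0]
    exact hasFDerivAt_integral_smul_comp_sub hκ.continuous (hΦ.of_le (by norm_num)) hΦs p
  have e2 : ∫ t, Φ t • fderiv ℝ (fderiv ℝ κ) (p - t) ∂ν =
      ∫ t, κ t • fderiv ℝ (fderiv ℝ Φ) (p - t) ∂ν := by
    refine (hasFDerivAt_integral_smul_comp_sub hΦ.continuous hκ1' (hκs.fderiv ℝ)
      p).unique ?_
    simp only [e1]
    exact hasFDerivAt_integral_smul_comp_sub hκ.continuous hΦ1 (hΦs.fderiv ℝ) p
  refine ⟨?_, ?_, ?_⟩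
  · have A := (ha _ κ hκ.continuous _ K0 p).trans hle
    have B := dist_integral_mollifier_le hκ.continuous hκs hκ0 hκ1 hκδ hΦ.continuous H0 p
    rw [e0, dist_comm] at A
    linarith [dist_triangle _ _ _ |>.trans (add_le_add A B)]
  · have A := (ha _ (fderiv ℝ κ) hκ1'.continuous _ K1 p).trans hle
    have B := dist_integral_mollifier_le hκ.continuous hκs hκ0 hκ1 hκδ hΦ1.continuous H1 p
    rw [e1, dist_comm] at A
    linarith [dist_triangle _ _ _ |>.trans (add_le_add A B)]
  · have A := (ha (G →L[ℝ] G →L[ℝ] ℝ) (fderiv ℝ (fderiv ℝ κ)) hκ2 _ K2 p).trans hle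
    have B := @dist_integral_mollifier_le G (G →L[ℝ] G →L[ℝ] ℝ) _ _ _ _ _ _ ν _ κ
      hκ.continuous hκs hκ0 hκ1 δ hκδ (fderiv ℝ (fderiv ℝ Φ)) hΦ2 _ H2 p
    rw [e2, dist_comm] at A
    linarith [dist_triangle _ _ _ |>.trans (add_le_add A B)]

end Mollification

lemma exists_mollifier {E : Type*} [NormedAddCommGroup E] [InnerProductSpace ℝ E]
    [FiniteDimensional ℝ E] [MeasurableSpace E] [BorelSpace E] (ν : Measure E)
    [ν.IsAddHaarMeasure] {δ : ℝ} (hδ : 0 < δ) :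
    ∃ b : E → ℝ, ContDiff ℝ (⊤ : ℕ∞) b ∧ HasCompactSupport b ∧ (∀ x, 0 ≤ b x) ∧
      ∫ x, b x ∂ν = 1 ∧ ∀ x, b x ≠ 0 → ‖x‖ < δ := by
  let B : ContDiffBump (0 : E) := ⟨δ / 2, δ, half_pos hδ, half_lt_self hδ⟩
  refine ⟨B.normed ν, B.contDiff_normed, B.hasCompactSupport_normed, B.nonneg_normed,
    B.integral_normed, fun x hx => ?_⟩
  have : x ∈ Function.support (B.normed ν) := hx
  rw [B.support_normed_eq] at this
  simpa using this

lemma hasCompactSupport_comp_sub {E : Type*} [NormedAddCommGroup E] {b : E → ℝ}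
    (hb : HasCompactSupport b) (q : E) : HasCompactSupport fun x => b (x - q) :=
  hb.comp_homeomorph (Homeomorph.subRight q)

lemma isTest_comp_sub {c : ℝ → ℝ} (hc : ContDiff ℝ (⊤ : ℕ∞) c) (hcs : HasCompactSupport c)
    {η q : ℝ} (hη : ∀ t, c t ≠ 0 → |t| < η) (hq : η < q) : IsTest fun t => c (t - q) := by
  refine ⟨hc.comp (contDiff_id.sub contDiff_const), hasCompactSupport_comp_sub hcs q, ?_⟩
  have hsub : tsupport (fun t => c (t - q)) ⊆ Ici (q - η) := by
    refine closure_minimal (fun t ht => ?_) isClosed_Ici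
    have := (abs_lt.1 (hη _ ht)).1
    simp only [mem_Ici]
    linarith
  exact hsub.trans fun t ht => lt_of_lt_of_le (sub_pos.2 hq) ht

/-- Kernels of class `C²_c` supported in `{z > 0}` are approximated, together with their first two
derivatives, by finite sums of products. -/
lemma exists_mem_sepKernels_jet_approx {Φ : Ph d r → ℝ} (hΦ : ContDiff ℝ 2 Φ)
    (hΦs : HasCompactSupport Φ) (hpos : ∀ p ∈ tsupport Φ, 0 < p.2) {ε : ℝ} (hε : 0 < ε) :
    ∃ Ψ ∈ sepKernels d r, ∀ p, dist (Ψ p) (Φ p) ≤ ε ∧ dist (fderiv ℝ Ψ p) (fderiv ℝ Φ p) ≤ ε ∧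
      dist (fderiv ℝ (fderiv ℝ Ψ) p) (fderiv ℝ (fderiv ℝ Φ) p) ≤ ε := by
  obtain ⟨η, hη, hηq⟩ : ∃ η > 0, ∀ p ∈ tsupport Φ, η < p.2 := by
    rcases (tsupport Φ).eq_empty_or_nonempty with h | h
    · exact ⟨1, one_pos, by simp [h]⟩
    · obtain ⟨p₀, hp₀, hmin⟩ := hΦs.isCompact.exists_isMinOn h continuous_snd.continuousOn
      exact ⟨p₀.2 / 2, half_pos (hpos _ hp₀), fun p hp =>
        (half_lt_self (hpos _ hp₀)).trans_le (hmin hp)⟩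
  have : (volume : Measure (Ph d r)).IsAddHaarMeasure :=
    Measure.prod.instIsAddHaarMeasure volume volume
  obtain ⟨δ, hδ, H⟩ := exists_sum_translates_jet_approx volume hΦ hΦs hε
  obtain ⟨b, hb, hbs, hb0, hb1, hbδ⟩ := exists_mollifier (volume : Measure (Eu d)) hδ
  obtain ⟨c, hc, hcs, hc0, hc1, hcδ⟩ :=
    exists_mollifier (volume : Measure ℝ) (lt_min hδ hη)
  set κ : Ph d r → ℝ := prodFun c (fun _ => b) with hκ
  have hκ2 : ContDiff ℝ 2 κ := by
    refine ContDiff.mul ((hc.of_le (by norm_cast)).comp contDiff_snd) ?_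
    refine contDiff_prod fun i _ => (hb.of_le (by norm_cast)).comp ?_
    exact (contDiff_apply ℝ (Eu d) i).comp contDiff_fst
  have hκδ : ∀ t, κ t ≠ 0 → ‖t‖ < δ := by
    intro t ht
    refine max_lt ((pi_norm_lt_iff hδ).2 fun i => hbδ _ ?_)
      ((hcδ _ (left_ne_zero_of_mul ht)).trans_le (min_le_left _ _))
    exact Finset.prod_ne_zero_iff.1 (right_ne_zero_of_mul ht) i (Finset.mem_univ i)
  have hκs : HasCompactSupport κ :=
    HasCompactSupport.of_support_subset_isCompact (isCompact_closedBall 0 δ) fun t ht => by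
      simpa using (hκδ t ht).le
  have hκ1 : ∫ t, κ t = 1 := by
    simp only [hκ, prodFun]
    have h1 : ∫ t : Ph d r, c t.2 * ∏ i, b (t.1 i) = ∫ t : Ph d r, (∏ i, b (t.1 i)) * c t.2 := by
      simp only [mul_comm]
    rw [h1, Measure.volume_eq_prod,
      integral_prod_mul (fun w : Fin r → Eu d => ∏ i, b (w i)) c, hc1, mul_one, volume_pi,
      integral_fintype_prod_eq_prod (fun _ : Fin r => b)]
    simp [hb1]
  obtain ⟨s, a, hs, hsa⟩ := H κ hκ2 hκs
    (fun t => mul_nonneg (hc0 _) (Finset.prod_nonneg fun i _ => hb0 _)) hκ1 hκδ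
  have e1 : fderiv ℝ (fun p => ∑ q ∈ s, a q • κ (p - q)) =
      fun p => ∑ q ∈ s, a q • fderiv ℝ κ (p - q) :=
    funext fun p => (hasFDerivAt_sum_translates (hκ2.differentiable (by norm_num)) s a p).fderiv
  have e2 : fderiv ℝ (fun p => ∑ q ∈ s, a q • fderiv ℝ κ (p - q)) =
      fun p => ∑ q ∈ s, a q • fderiv ℝ (fderiv ℝ κ) (p - q) :=
    funext fun p => (hasFDerivAt_sum_translates
      ((hκ2.fderiv_right (m := 1) (by norm_num)).differentiable (by norm_num)) s a p).fderiv
  refine ⟨fun p => ∑ q ∈ s, a q • κ (p - q), ?_, fun p => ?_⟩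
  · have : (fun p => ∑ q ∈ s, a q • κ (p - q)) = ∑ q ∈ s, a q • fun p => κ (p - q) := by
      ext p; simp
    rw [this]
    refine Submodule.sum_mem _ fun q hq => Submodule.smul_mem _ _ ?_
    refine prodFun_mem (c := fun t => c (t - q.2)) (ψ := fun i x => b (x - q.1 i))
      (isTest_comp_sub hc hcs (fun t ht => (hcδ t ht).trans_le (min_le_right _ _))
        (hηq q (hs q hq))) fun i => ?_
    exact isCb2_of_hasCompactSupport ((hb.of_le (by norm_cast)).comp
      (contDiff_id.sub contDiff_const)) (hasCompactSupport_comp_sub hbs _)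
  · rw [e1, e2]
    exact hsa p

/-! ### Integration against product measures on compact sets -/

section Integration

variable {N : ℕ} {k : ℝ} {μ : Md d} {V : Type*} [NormedAddCommGroup V] [NormedSpace ℝ V]

lemma isCompact_KN : IsCompact (KN d N) := by
  have h : KN d N = EuclideanSpace.equiv (Fin d) ℝ ⁻¹' (Set.pi univ fun _ => Icc (-(N : ℝ)) N) := by
    ext x
    simp [KN, abs_le, Pi.le_def, forall_and]
  rw [h]
  exact (EuclideanSpace.equiv (Fin d) ℝ).toHomeomorph.isClosedEmbedding.isCompact_preimage
    (isCompact_univ_pi fun _ => isCompact_Icc)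

lemma isCompact_pi_KN : IsCompact {w : Fin r → Eu d | ∀ i, w i ∈ KN d N} := by
  have := isCompact_univ_pi fun _ : Fin r => isCompact_KN (d := d) (N := N)
  simpa [Set.pi] using this

lemma ae_pi_mem_KN (hμ : μ ∈ HNk d N k) :
    ∀ᵐ w ∂(Measure.pi fun _ : Fin r => (μ : Measure (Eu d))), ∀ i, w i ∈ KN d N :=
  eventually_all.2 fun i => (Measure.tendsto_eval_ae_ae (i := i)).eventually (ae_mem_KN hμ)

lemma integrable_pi_of_continuous {V : Type*} [NormedAddCommGroup V] (hμ : μ ∈ HNk d N k)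
    {a : (Fin r → Eu d) → V}
    (ha : Continuous a) : Integrable a (Measure.pi fun _ : Fin r => (μ : Measure (Eu d))) := by
  obtain ⟨C, hC⟩ := isCompact_pi_KN.exists_bound_of_continuousOn (f := a) ha.continuousOn
  refine Integrable.of_bound ha.aestronglyMeasurable C ?_
  filter_upwards [ae_pi_mem_KN hμ] with w hw using hC w hw

lemma hasFDerivAt_lift {E : Type*} [NormedAddCommGroup E] [NormedSpace ℝ E]
    [FiniteDimensional ℝ E] (hμ : μ ∈ HNk d N k) {a : E → Ph d r → V}
    {a' : E → Ph d r → E →L[ℝ] V} (ha : ∀ x, Continuous fun w => a x (w, μ.mass))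
    (ha' : Continuous fun q : E × (Fin r → Eu d) => a' q.1 (q.2, μ.mass))
    (h : ∀ x w, HasFDerivAt (fun x => a x (w, μ.mass)) (a' x (w, μ.mass)) x) (x₀ : E) :
    HasFDerivAt (fun x => lift (a x) μ) (lift (a' x₀) μ) x₀ := by
  have : ProperSpace E := FiniteDimensional.proper ℝ E
  obtain ⟨C, hC⟩ := ((isCompact_closedBall x₀ 1).prod
    (isCompact_pi_KN (d := d) (r := r) (N := N))).exists_bound_of_continuousOn ha'.continuousOn
  have hc : Continuous fun w : Fin r → Eu d => a' x₀ (w, μ.mass) :=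
    ha'.comp (Continuous.prodMk_right x₀)
  refine hasFDerivAt_integral_of_dominated_of_fderiv_le (bound := fun _ => C)
    (F' := fun x w => a' x (w, μ.mass))
    (Metric.closedBall_mem_nhds x₀ one_pos)
    (Eventually.of_forall fun x => (ha x).aestronglyMeasurable)
    (integrable_pi_of_continuous hμ (ha x₀)) hc.aestronglyMeasurable ?_ (integrable_const C)
    (ae_of_all _ fun w x _ => h x w)
  filter_upwards [ae_pi_mem_KN hμ] with w hw x hx using hC (x, w) ⟨hx, hw⟩

lemma hasGradientAt_lift (hμ : μ ∈ HNk d N k) {a : Eu d → Ph d r → ℝ}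
    {g : Eu d → Ph d r → Eu d} (ha : ∀ x, Continuous fun w => a x (w, μ.mass))
    (hg : Continuous fun q : Eu d × (Fin r → Eu d) => g q.1 (q.2, μ.mass))
    (h : ∀ x w, HasGradientAt (fun x => a x (w, μ.mass)) (g x (w, μ.mass)) x) (x₀ : Eu d) :
    HasGradientAt (fun x => lift (a x) μ) (lift (g x₀) μ) x₀ := by
  have hg' : Continuous fun q : Eu d × (Fin r → Eu d) =>
      InnerProductSpace.toDual ℝ (Eu d) (g q.1 (q.2, μ.mass)) :=
    (InnerProductSpace.toDual ℝ (Eu d)).continuous.comp hg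
  have hc : Continuous fun w : Fin r → Eu d => g x₀ (w, μ.mass) :=
    hg.comp (Continuous.prodMk_right x₀)
  have hc' : Continuous fun w : Fin r → Eu d =>
      InnerProductSpace.toDual ℝ (Eu d) (g x₀ (w, μ.mass)) :=
    (InnerProductSpace.toDual ℝ (Eu d)).continuous.comp hc
  have key := hasFDerivAt_lift hμ (a := a)
    (a' := fun x p => InnerProductSpace.toDual ℝ (Eu d) (g x p)) ha hg'
    (fun x w => (h x w).hasFDerivAt) x₀
  have e : InnerProductSpace.toDual ℝ (Eu d) (lift (g x₀) μ) =
      lift (fun p => InnerProductSpace.toDual ℝ (Eu d) (g x₀ p)) μ := by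
    ext1 y
    unfold lift
    rw [ContinuousLinearMap.integral_apply (integrable_pi_of_continuous hμ hc')]
    simp only [InnerProductSpace.toDual_apply_apply, real_inner_comm y]
    exact (integral_inner (integrable_pi_of_continuous hμ hc) y).symm
  rw [hasGradientAt_iff_hasFDerivAt, e]
  exact key

/-- The set `K_N^r × [1/k,k]`. -/
def phaseBox (d r N : ℕ) (k : ℝ) : Set (Ph d r) :=
  {p | (∀ i, p.1 i ∈ KN d N) ∧ 1 / k ≤ p.2 ∧ p.2 ≤ k}

lemma tendstoUniformlyOn_lift {Q : Type*} {T : Set Q} {A : ℕ → Q → Ph d r → V}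
    {A' : Q → Ph d r → V}
    (hA : ∀ n q, ∀ μ ∈ HNk d N k, Continuous fun w => A n q (w, μ.mass))
    (hA' : ∀ q, ∀ μ ∈ HNk d N k, Continuous fun w => A' q (w, μ.mass))
    (h : TendstoUniformlyOn (fun n (q : Q × Ph d r) => A n q.1 q.2) (fun q => A' q.1 q.2) atTop
      (T ×ˢ phaseBox d r N k)) :
    TendstoUniformlyOn (fun n (q : Md d × Q) => lift (A n q.2) q.1)
      (fun q => lift (A' q.2) q.1) atTop (HNk d N k ×ˢ T) := by
  rw [Metric.tendstoUniformlyOn_iff] at h ⊢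
  intro ε hε
  filter_upwards [h (ε / (|k| ^ r + 1)) (by positivity)] with n hn
  rintro ⟨μ, q⟩ ⟨hμ, hq⟩
  have hmass : (Measure.pi fun _ : Fin r => (μ : Measure (Eu d))).real univ ≤ |k| ^ r := by
    have h1 : (Measure.pi fun _ : Fin r => (μ : Measure (Eu d))).real univ = (μ.mass : ℝ) ^ r := by
      rw [Measure.real, Measure.pi_univ]
      simp
      rfl
    rw [h1]
    exact pow_le_pow_left₀ μ.mass.2 (hμ.2.2.trans (le_abs_self k)) r
  have hlt : ε / (|k| ^ r + 1) * |k| ^ r < ε := by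
    rw [div_mul_eq_mul_div, div_lt_iff₀ (by positivity)]
    nlinarith
  simp only [dist_eq_norm, lift]
  rw [← integral_sub (integrable_pi_of_continuous hμ (hA' q μ hμ))
    (integrable_pi_of_continuous hμ (hA n q μ hμ))]
  refine ((norm_integral_le_of_norm_le_const (C := ε / (|k| ^ r + 1)) ?_).trans
    (mul_le_mul_of_nonneg_left hmass (by positivity))).trans_lt hlt
  filter_upwards [ae_pi_mem_KN hμ] with w hw
  rw [← dist_eq_norm]
  exact (hn (q, (w, μ.mass)) ⟨hq, hw, hμ.2⟩).le

end Integration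

/-! ### Spatial derivatives of the kernels -/

/-- The Riesz isomorphism, as a continuous linear map. -/
def rieszInv : (Eu d →L[ℝ] ℝ) →L[ℝ] Eu d where
  toFun := (InnerProductSpace.toDual ℝ (Eu d)).symm
  map_add' := map_add _
  map_smul' c ℓ := by simp
  cont := (InnerProductSpace.toDual ℝ (Eu d)).symm.continuous

/-- The gradient in the `i`-th spatial coordinate associated with a differential. -/
def gradAt (i : Fin r) : (Ph d r →L[ℝ] ℝ) →L[ℝ] Eu d :=
  rieszInv.comp ((insAt i).precomp ℝ)

/-- The spatial gradient of `kd Ψ`. -/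
def gradKd (Ψ : Ph d r → ℝ) (x : Eu d) (p : Ph d r) : Eu d :=
  p.2⁻¹ • ∑ i, gradAt i (fderiv ℝ Ψ (delAt i p + insAt i x))

/-- The spatial Jacobian of `gradKd Ψ`. -/
def jacKd (Ψ : Ph d r → ℝ) (x : Eu d) (p : Ph d r) : Eu d →L[ℝ] Eu d :=
  p.2⁻¹ • ∑ i, (gradAt i).comp ((fderiv ℝ (fderiv ℝ Ψ) (delAt i p + insAt i x)).comp (insAt i))

/-- Explicit form of the iterated kernel `kd (kd Ψ x) y`. -/
def kdTwo (Ψ : Ph d r → ℝ) (x y : Eu d) (p : Ph d r) : ℝ :=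
  fderiv ℝ (fderiv ℝ Ψ) p (0, 1) (0, 1) +
    (-(p.2 ^ 2)⁻¹ * ∑ i, Ψ (delAt i p + insAt i x) +
      p.2⁻¹ * ∑ i, fderiv ℝ Ψ (delAt i p + insAt i x) (0, 1)) +
    p.2⁻¹ * ∑ j, (fderiv ℝ Ψ (delAt j p + insAt j y) (0, 1) +
      p.2⁻¹ * ∑ i, Ψ (delAt i (delAt j p + insAt j y) + insAt i x))

/-- The gradient of `kdTwo Ψ` in the first spatial variable. -/
def gradKdTwo (Ψ : Ph d r → ℝ) (x y : Eu d) (p : Ph d r) : Eu d :=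
  (-(p.2 ^ 2)⁻¹ • ∑ i, gradAt i (fderiv ℝ Ψ (delAt i p + insAt i x)) +
      p.2⁻¹ • ∑ i, gradAt i ((fderiv ℝ (fderiv ℝ Ψ) (delAt i p + insAt i x)).flip (0, 1))) +
    p.2⁻¹ • ∑ j, p.2⁻¹ • ∑ i,
      gradAt i (fderiv ℝ Ψ (delAt i (delAt j p + insAt j y) + insAt i x))

/-- The Jacobian of `gradKdTwo Ψ` in the second spatial variable. -/
def jacKdTwo (Ψ : Ph d r → ℝ) (x y : Eu d) (p : Ph d r) : Eu d →L[ℝ] Eu d :=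
  p.2⁻¹ • ∑ j, p.2⁻¹ • ∑ i, (gradAt i).comp
    ((fderiv ℝ (fderiv ℝ Ψ) (delAt i (delAt j p + insAt j y) + insAt i x)).comp
      ((delAt i).comp (insAt j)))

section Kernels

variable {Ψ : Ph d r → ℝ}

lemma hasFDerivAt_replace (i : Fin r) (p : Ph d r) (x : Eu d) :
    HasFDerivAt (fun x => delAt i p + insAt i x) (insAt i) x :=
  (insAt i).hasFDerivAt.const_add _

lemma hasFDerivAt_replace_left (i : Fin r) (p : Ph d r) (x : Eu d) :
    HasFDerivAt (fun p => delAt i p + insAt i x) (delAt i) p :=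
  (delAt i).hasFDerivAt.add_const _

lemma delAt_snd (i : Fin r) (p : Ph d r) (x : Eu d) : (delAt i p + insAt i x).2 = p.2 := by
  rw [delAt_add_insAt]

lemma delAt_zero_one (i : Fin r) : delAt (d := d) i (0, 1) = (0, 1) := by
  simp [delAt, insAt]

lemma HasFDerivAt.hasGradientAt_rieszInv {f : Eu d → ℝ} {ℓ : Eu d →L[ℝ] ℝ} {x : Eu d}
    (h : HasFDerivAt f ℓ x) : HasGradientAt f (rieszInv ℓ) x :=
  h.hasGradientAt

lemma differentiable_fderiv (hΨ : ContDiff ℝ 2 Ψ) : Differentiable ℝ (fderiv ℝ Ψ) :=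
  (hΨ.fderiv_right (m := 1) (by norm_num)).differentiable (by norm_num)

lemma hasFDerivAt_comp_replace (hΨ : ContDiff ℝ 2 Ψ) (i : Fin r) (p : Ph d r) (x : Eu d) :
    HasFDerivAt (fun x => Ψ (delAt i p + insAt i x))
      ((fderiv ℝ Ψ (delAt i p + insAt i x)).comp (insAt i)) x :=
  (hΨ.differentiable (by norm_num) _).hasFDerivAt.comp x (hasFDerivAt_replace i p x)

lemma hasGradientAt_kd (hΨ : ContDiff ℝ 2 Ψ) (p : Ph d r) (x : Eu d) :
    HasGradientAt (fun x => kd Ψ x p) (gradKd Ψ x p) x := by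
  have h : HasFDerivAt (fun x => kd Ψ x p)
      (p.2⁻¹ • ∑ i, (fderiv ℝ Ψ (delAt i p + insAt i x)).comp (insAt i)) x :=
    ((HasFDerivAt.fun_sum fun i _ => hasFDerivAt_comp_replace hΨ i p x).const_mul _).const_add _
  convert h.hasGradientAt_rieszInv using 1
  simp only [map_smul, map_sum]
  rfl

lemma hasFDerivAt_gradAt (hΨ : ContDiff ℝ 2 Ψ) (i : Fin r) (p : Ph d r) (x : Eu d) :
    HasFDerivAt (fun x => gradAt i (fderiv ℝ Ψ (delAt i p + insAt i x)))
      ((gradAt i).comp ((fderiv ℝ (fderiv ℝ Ψ) (delAt i p + insAt i x)).comp (insAt i))) x :=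
  (gradAt i).hasFDerivAt.comp x
    ((differentiable_fderiv hΨ _).hasFDerivAt.comp x (hasFDerivAt_replace i p x))

lemma hasFDerivAt_gradKd (hΨ : ContDiff ℝ 2 Ψ) (p : Ph d r) (x : Eu d) :
    HasFDerivAt (fun x => gradKd Ψ x p) (jacKd Ψ x p) x :=
  (HasFDerivAt.fun_sum fun i _ => hasFDerivAt_gradAt hΨ i p x).fun_const_smul _

lemma hasFDerivAt_fderiv_apply (hΨ : ContDiff ℝ 2 Ψ) (p : Ph d r) :
    HasFDerivAt (fun p => fderiv ℝ Ψ p (0, 1)) ((fderiv ℝ (fderiv ℝ Ψ) p).flip (0, 1)) p :=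
  (ContinuousLinearMap.apply ℝ ℝ ((0, 1) : Ph d r)).hasFDerivAt.comp p
    (differentiable_fderiv hΨ p).hasFDerivAt

lemma kd_kd (hΨ : ContDiff ℝ 2 Ψ) (x y : Eu d) {p : Ph d r} (hp : p.2 ≠ 0) :
    kd (kd Ψ x) y p = kdTwo Ψ x y p := by
  have h1 : HasFDerivAt (fun p : Ph d r => p.2⁻¹)
      (-(p.2 ^ 2)⁻¹ • ContinuousLinearMap.snd ℝ (Fin r → Eu d) ℝ) p :=
    (hasDerivAt_inv hp).comp_hasFDerivAt p hasFDerivAt_snd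
  have h2 : HasFDerivAt (fun p : Ph d r => ∑ i, Ψ (delAt i p + insAt i x))
      (∑ i, (fderiv ℝ Ψ (delAt i p + insAt i x)).comp (delAt i)) p :=
    HasFDerivAt.fun_sum fun i _ => (hΨ.differentiable (by norm_num) _).hasFDerivAt.comp p
      (hasFDerivAt_replace_left i p x)
  have h3 := ((hasFDerivAt_fderiv_apply hΨ p).add (h1.mul h2)).fderiv
  have h4 : fderiv ℝ (kd Ψ x) p (0, 1) = fderiv ℝ (fderiv ℝ Ψ) p (0, 1) (0, 1) +
      (-(p.2 ^ 2)⁻¹ * ∑ i, Ψ (delAt i p + insAt i x) +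
      p.2⁻¹ * ∑ i, fderiv ℝ Ψ (delAt i p + insAt i x) (0, 1)) := by
    refine (congrArg (fun L : Ph d r →L[ℝ] ℝ => L (0, 1)) h3).trans ?_
    simp [delAt_zero_one]
    ring
  rw [kd, h4]
  simp only [kd, kdTwo, delAt_snd]

lemma hasGradientAt_kdTwo (hΨ : ContDiff ℝ 2 Ψ) (y : Eu d) (p : Ph d r) (x : Eu d) :
    HasGradientAt (fun x => kdTwo Ψ x y p) (gradKdTwo Ψ x y p) x := by
  have h1 : ∀ i, HasFDerivAt (fun x => fderiv ℝ Ψ (delAt i p + insAt i x) (0, 1))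
      (((fderiv ℝ (fderiv ℝ Ψ) (delAt i p + insAt i x)).flip (0, 1)).comp (insAt i)) x :=
    fun i => (hasFDerivAt_fderiv_apply hΨ _).comp x (hasFDerivAt_replace i p x)
  have h := (((HasFDerivAt.fun_sum fun i (_ : i ∈ Finset.univ) =>
    hasFDerivAt_comp_replace hΨ i p x).const_mul (-(p.2 ^ 2)⁻¹)).add
      ((HasFDerivAt.fun_sum fun i (_ : i ∈ Finset.univ) => h1 i).const_mul p.2⁻¹)).const_add
      (fderiv ℝ (fderiv ℝ Ψ) p (0, 1) (0, 1)) |>.add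
    ((HasFDerivAt.fun_sum fun j (_ : j ∈ Finset.univ) =>
      ((HasFDerivAt.fun_sum fun i (_ : i ∈ Finset.univ) => hasFDerivAt_comp_replace hΨ i
        (delAt j p + insAt j y) x).const_mul p.2⁻¹).const_add
        (fderiv ℝ Ψ (delAt j p + insAt j y) (0, 1))).const_mul p.2⁻¹)
  convert h.hasGradientAt_rieszInv using 1
  · rfl
  · simp only [gradKdTwo, map_add, map_smul, map_sum]
    rfl

lemma hasFDerivAt_gradKdTwo (hΨ : ContDiff ℝ 2 Ψ) (x : Eu d) (p : Ph d r) (y : Eu d) :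
    HasFDerivAt (fun y => gradKdTwo Ψ x y p) (jacKdTwo Ψ x y p) y := by
  have h1 : ∀ i j, HasFDerivAt (fun y => gradAt i
      (fderiv ℝ Ψ (delAt i (delAt j p + insAt j y) + insAt i x)))
      ((gradAt i).comp
        ((fderiv ℝ (fderiv ℝ Ψ) (delAt i (delAt j p + insAt j y) + insAt i x)).comp
          ((delAt i).comp (insAt j)))) y := fun i j =>
    (gradAt i).hasFDerivAt.comp y ((differentiable_fderiv hΨ _).hasFDerivAt.comp y
      ((hasFDerivAt_replace_left i _ x).comp y (hasFDerivAt_replace j p y)))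
  have h2 : ∀ j, HasFDerivAt (fun y => p.2⁻¹ • ∑ i, gradAt i
      (fderiv ℝ Ψ (delAt i (delAt j p + insAt j y) + insAt i x)))
      (p.2⁻¹ • ∑ i, (gradAt i).comp
        ((fderiv ℝ (fderiv ℝ Ψ) (delAt i (delAt j p + insAt j y) + insAt i x)).comp
          ((delAt i).comp (insAt j)))) y := fun j =>
    (HasFDerivAt.fun_sum fun i _ => h1 i j).fun_const_smul _
  exact ((HasFDerivAt.fun_sum fun j _ => h2 j).fun_const_smul _).const_add _

end Kernels

/-! ### Continuity and uniform convergence of the kernels -/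

lemma tendstoUniformlyOn_finsetSum {ι α κ V : Type*} [NormedAddCommGroup V] {l : Filter κ}
    {S : Set α} (s : Finset ι) {F : ι → κ → α → V} {f : ι → α → V}
    (h : ∀ i, TendstoUniformlyOn (F i) (f i) l S) :
    TendstoUniformlyOn (fun n a => ∑ i ∈ s, F i n a) (fun a => ∑ i ∈ s, f i a) l S := by
  classical
  induction s using Finset.induction_on with
  | empty =>
    simp only [Finset.sum_empty]
    exact fun u hu => Eventually.of_forall fun _ _ _ => refl_mem_uniformity hu
  | insert i s hi ih =>
    simp only [Finset.sum_insert hi]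
    exact (h i).add ih

lemma TendstoUniformlyOn.smul_of_bounded {α κ V : Type*} [NormedAddCommGroup V]
    [NormedSpace ℝ V] {l : Filter κ} {S : Set α} {F : κ → α → V} {f : α → V}
    (h : TendstoUniformlyOn F f l S) {b : α → ℝ} {C : ℝ} (hb : ∀ a ∈ S, |b a| ≤ C) :
    TendstoUniformlyOn (fun n a => b a • F n a) (fun a => b a • f a) l S := by
  rw [Metric.tendstoUniformlyOn_iff] at h ⊢
  intro ε hε
  filter_upwards [h (ε / (|C| + 1)) (by positivity)] with n hn a ha
  rw [dist_smul₀, Real.norm_eq_abs]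
  have h1 : |b a| < |C| + 1 := ((hb a ha).trans (le_abs_self C)).trans_lt (lt_add_one _)
  have h2 := hn a ha
  rw [lt_div_iff₀ (by positivity)] at h2
  calc |b a| * dist (f a) (F n a) ≤ dist (f a) (F n a) * (|C| + 1) := by
        rw [mul_comm]
        exact mul_le_mul_of_nonneg_left h1.le dist_nonneg
    _ < ε := h2

/-- The map `B ↦ B(·, v)` on bilinear forms. -/
def flipApply (v : Ph d r) : (Ph d r →L[ℝ] Ph d r →L[ℝ] ℝ) →L[ℝ] (Ph d r →L[ℝ] ℝ) :=
  (ContinuousLinearMap.apply ℝ ℝ v).postcomp (Ph d r)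

/-- The map sending a bilinear form to the derivative of `gradAt i` in the direction `M`. -/
def hessAt (i : Fin r) (M : Eu d →L[ℝ] Ph d r) :
    (Ph d r →L[ℝ] Ph d r →L[ℝ] ℝ) →L[ℝ] (Eu d →L[ℝ] Eu d) :=
  ((gradAt i).postcomp (Eu d)).comp (M.precomp (Ph d r →L[ℝ] ℝ))

lemma flip_apply_eq (B : Ph d r →L[ℝ] Ph d r →L[ℝ] ℝ) (v : Ph d r) : B.flip v = flipApply v B :=
  rfl

lemma comp_comp_eq_hessAt (i : Fin r) (M : Eu d →L[ℝ] Ph d r) (B : Ph d r →L[ℝ] Ph d r →L[ℝ] ℝ) :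
    (gradAt i).comp (B.comp M) = hessAt i M B :=
  rfl

lemma apply_apply_eq (B : Ph d r →L[ℝ] Ph d r →L[ℝ] ℝ) (v : Ph d r) :
    B v v = flipApply v B v :=
  rfl

section Continuity

variable {Ψ : Ph d r → ℝ} (hΨ : ContDiff ℝ 2 Ψ)

include hΨ
lemma continuous_clm_fderiv_fderiv {V : Type*} [NormedAddCommGroup V] [NormedSpace ℝ V]
    (L : (Ph d r →L[ℝ] Ph d r →L[ℝ] ℝ) →L[ℝ] V) : Continuous fun p => L (fderiv ℝ (fderiv ℝ Ψ) p) :=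
  L.continuous.comp ((hΨ.fderiv_right (m := 1) (by norm_num)).continuous_fderiv (by norm_num))

end Continuity

section Continuity

variable {Ψ : Ph d r → ℝ} (hΨ : ContDiff ℝ 2 Ψ) {X : Type*} [TopologicalSpace X]
  {x y : X → Eu d} {p : X → Ph d r}

lemma continuous_replace (i : Fin r) (hx : Continuous x) (hp : Continuous p) :
    Continuous fun q => delAt i (p q) + insAt i (x q) :=
  ((delAt i).continuous.comp hp).add ((insAt i).continuous.comp hx)

include hΨ

lemma continuous_kd (hx : Continuous x) (hp : Continuous p) (hz : ∀ q, (p q).2 ≠ 0) :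
    Continuous fun q => kd Ψ (x q) (p q) := by
  have h1 := hΨ.continuous_fderiv (by norm_num)
  have h0 := hΨ.continuous
  have hr := fun i => continuous_replace i hx hp
  have hi : Continuous fun q => (p q).2⁻¹ := hp.snd.inv₀ hz
  unfold kd
  fun_prop

lemma continuous_gradKd (hx : Continuous x) (hp : Continuous p) (hz : ∀ q, (p q).2 ≠ 0) :
    Continuous fun q => gradKd Ψ (x q) (p q) := by
  have h1 := hΨ.continuous_fderiv (by norm_num)
  have hr := fun i => continuous_replace i hx hp
  have hi : Continuous fun q => (p q).2⁻¹ := hp.snd.inv₀ hz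
  unfold gradKd
  fun_prop

lemma continuous_jacKd (hx : Continuous x) (hp : Continuous p) (hz : ∀ q, (p q).2 ≠ 0) :
    Continuous fun q => jacKd Ψ (x q) (p q) := by
  have hi : Continuous fun q => (p q).2⁻¹ := hp.snd.inv₀ hz
  unfold jacKd
  simp only [comp_comp_eq_hessAt]
  exact hi.smul (continuous_finsetSum _ fun i _ =>
    (continuous_clm_fderiv_fderiv hΨ _).comp (continuous_replace i hx hp))

lemma continuous_kdTwo (hx : Continuous x) (hy : Continuous y) (hp : Continuous p)
    (hz : ∀ q, (p q).2 ≠ 0) : Continuous fun q => kdTwo Ψ (x q) (y q) (p q) := by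
  have h1 := hΨ.continuous_fderiv (by norm_num)
  have h0 := hΨ.continuous
  have hr := fun i => continuous_replace i hx hp
  have hr' := fun i => continuous_replace i hy hp
  have hrr := fun i j => continuous_replace i hx (hr' j)
  have hi : Continuous fun q => (p q).2⁻¹ := hp.snd.inv₀ hz
  have hi' : Continuous fun q => ((p q).2 ^ 2)⁻¹ :=
    (hp.snd.pow 2).inv₀ fun q => pow_ne_zero 2 (hz q)
  have h2 := (continuous_clm_fderiv_fderiv hΨ (flipApply (0, 1))).comp hp
  unfold kdTwo
  simp only [apply_apply_eq]
  fun_prop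

lemma continuous_gradKdTwo (hx : Continuous x) (hy : Continuous y) (hp : Continuous p)
    (hz : ∀ q, (p q).2 ≠ 0) : Continuous fun q => gradKdTwo Ψ (x q) (y q) (p q) := by
  have h1 := hΨ.continuous_fderiv (by norm_num)
  have hr := fun i => continuous_replace i hx hp
  have hr' := fun i => continuous_replace i hy hp
  have hrr := fun i j => continuous_replace i hx (hr' j)
  have hi : Continuous fun q => (p q).2⁻¹ := hp.snd.inv₀ hz
  have hi' : Continuous fun q => ((p q).2 ^ 2)⁻¹ :=
    (hp.snd.pow 2).inv₀ fun q => pow_ne_zero 2 (hz q)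
  have h2 := fun i => (continuous_clm_fderiv_fderiv hΨ (flipApply (0, 1))).comp (hr i)
  unfold gradKdTwo
  simp only [flip_apply_eq]
  fun_prop

lemma continuous_jacKdTwo (hx : Continuous x) (hy : Continuous y) (hp : Continuous p)
    (hz : ∀ q, (p q).2 ≠ 0) : Continuous fun q => jacKdTwo Ψ (x q) (y q) (p q) := by
  have hi : Continuous fun q => (p q).2⁻¹ := hp.snd.inv₀ hz
  unfold jacKdTwo
  simp only [comp_comp_eq_hessAt]
  exact hi.smul (continuous_finsetSum _ fun j _ => hi.smul (continuous_finsetSum _ fun i _ =>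
    (continuous_clm_fderiv_fderiv hΨ _).comp
      (continuous_replace i hx (continuous_replace j hy hp))))

end Continuity

section UniformConvergence

variable {Ψ : ℕ → Ph d r → ℝ} {Φ : Ph d r → ℝ} {α : Type*} {S : Set α}

lemma ContinuousLinearMap.tendstoUniformlyOn_of_dist_le {G V X : Type*} [NormedAddCommGroup G]
    [NormedSpace ℝ G] [NormedAddCommGroup V] [NormedSpace ℝ V] (L : G →L[ℝ] V) {F : ℕ → X → G}
    {f : X → G} (h : ∀ n x, dist (F n x) (f x) ≤ 1 / ((n : ℝ) + 1)) (p : α → X) :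
    TendstoUniformlyOn (fun n a => L (F n (p a))) (fun a => L (f (p a))) atTop S := by
  have h1 : TendstoUniformly F f atTop := by
    rw [Metric.tendstoUniformly_iff]
    intro ε hε
    filter_upwards [tendsto_one_div_add_atTop_nhds_zero_nat.eventually (gt_mem_nhds hε)] with n hn x
    rw [dist_comm]
    exact (h n x).trans_lt hn
  exact (L.uniformContinuous.comp_tendstoUniformly (h1.comp p)).tendstoUniformlyOn

lemma abs_neg_inv_sq_le {p : α → Ph d r} {C : ℝ} (hC : ∀ a ∈ S, |(p a).2⁻¹| ≤ C) :
    ∀ a ∈ S, |-((p a).2 ^ 2)⁻¹| ≤ C ^ 2 := by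
  intro a ha
  rw [abs_neg, ← inv_pow, abs_pow]
  exact pow_le_pow_left₀ (abs_nonneg _) (hC a ha) 2

/-- Uniform convergence, at rate `1 / (n + 1)`, of functions and their first two derivatives. -/
def JetTendsto (Ψ : ℕ → Ph d r → ℝ) (Φ : Ph d r → ℝ) : Prop :=
  ∀ n p, dist (Ψ n p) (Φ p) ≤ 1 / ((n : ℝ) + 1) ∧
    dist (fderiv ℝ (Ψ n) p) (fderiv ℝ Φ p) ≤ 1 / ((n : ℝ) + 1) ∧
    dist (fderiv ℝ (fderiv ℝ (Ψ n)) p) (fderiv ℝ (fderiv ℝ Φ) p) ≤ 1 / ((n : ℝ) + 1)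

namespace JetTendsto

variable (h : JetTendsto Ψ Φ) {V : Type*} [NormedAddCommGroup V] [NormedSpace ℝ V]
  {x y : α → Eu d} {p : α → Ph d r}

include h

lemma comp_zero (p : α → Ph d r) :
    TendstoUniformlyOn (fun n a => Ψ n (p a)) (fun a => Φ (p a)) atTop S :=
  (ContinuousLinearMap.id ℝ ℝ).tendstoUniformlyOn_of_dist_le (fun n q => (h n q).1) p

lemma comp_one (L : (Ph d r →L[ℝ] ℝ) →L[ℝ] V) (p : α → Ph d r) :
    TendstoUniformlyOn (fun n a => L (fderiv ℝ (Ψ n) (p a))) (fun a => L (fderiv ℝ Φ (p a)))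
      atTop S :=
  L.tendstoUniformlyOn_of_dist_le (fun n q => (h n q).2.1) p

lemma comp_two (L : (Ph d r →L[ℝ] Ph d r →L[ℝ] ℝ) →L[ℝ] V) (p : α → Ph d r) :
    TendstoUniformlyOn (fun n a => L (fderiv ℝ (fderiv ℝ (Ψ n)) (p a)))
      (fun a => L (fderiv ℝ (fderiv ℝ Φ) (p a))) atTop S :=
  @ContinuousLinearMap.tendstoUniformlyOn_of_dist_le α S (Ph d r →L[ℝ] Ph d r →L[ℝ] ℝ) V (Ph d r)
    _ _ _ _ L (fun n => fderiv ℝ (fderiv ℝ (Ψ n))) (fderiv ℝ (fderiv ℝ Φ))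
    (fun n q => (h n q).2.2) p

lemma comp_apply (p : α → Ph d r) (v : Ph d r) :
    TendstoUniformlyOn (fun n a => fderiv ℝ (Ψ n) (p a) v) (fun a => fderiv ℝ Φ (p a) v)
      atTop S :=
  h.comp_one (ContinuousLinearMap.apply ℝ ℝ v) p

variable {C : ℝ} (hC : ∀ a ∈ S, |(p a).2⁻¹| ≤ C)

include hC

lemma kd : TendstoUniformlyOn (fun n a => kd (Ψ n) (x a) (p a)) (fun a => kd Φ (x a) (p a))
    atTop S :=
  (h.comp_apply p (0, 1)).add
    ((tendstoUniformlyOn_finsetSum _ fun _ => h.comp_zero _).smul_of_bounded hC)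

lemma gradKd : TendstoUniformlyOn (fun n a => gradKd (Ψ n) (x a) (p a))
    (fun a => gradKd Φ (x a) (p a)) atTop S :=
  (tendstoUniformlyOn_finsetSum _ fun i => h.comp_one (gradAt i) _).smul_of_bounded hC

lemma jacKd : TendstoUniformlyOn (fun n a => jacKd (Ψ n) (x a) (p a))
    (fun a => jacKd Φ (x a) (p a)) atTop S :=
  (tendstoUniformlyOn_finsetSum _ fun i => h.comp_two (hessAt i (insAt i)) _).smul_of_bounded hC

lemma jacKdTwo : TendstoUniformlyOn (fun n a => jacKdTwo (Ψ n) (x a) (y a) (p a))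
    (fun a => jacKdTwo Φ (x a) (y a) (p a)) atTop S :=
  (tendstoUniformlyOn_finsetSum _ fun j => (tendstoUniformlyOn_finsetSum _ fun i =>
    h.comp_two (hessAt i ((delAt i).comp (insAt j))) _).smul_of_bounded hC).smul_of_bounded hC

lemma kdTwo : TendstoUniformlyOn (fun n a => kdTwo (Ψ n) (x a) (y a) (p a))
    (fun a => kdTwo Φ (x a) (y a) (p a)) atTop S :=
  ((h.comp_two ((ContinuousLinearMap.apply ℝ ℝ (0, 1)).comp (flipApply (0, 1))) p).add
    (((tendstoUniformlyOn_finsetSum _ fun _ => h.comp_zero _).smul_of_bounded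
      (abs_neg_inv_sq_le hC)).add
      ((tendstoUniformlyOn_finsetSum _ fun _ => h.comp_apply _ (0, 1)).smul_of_bounded hC))).add
    ((tendstoUniformlyOn_finsetSum _ fun _ => (h.comp_apply _ (0, 1)).add
      ((tendstoUniformlyOn_finsetSum _ fun _ => h.comp_zero _).smul_of_bounded hC)).smul_of_bounded
      hC)

lemma gradKdTwo : TendstoUniformlyOn (fun n a => gradKdTwo (Ψ n) (x a) (y a) (p a))
    (fun a => gradKdTwo Φ (x a) (y a) (p a)) atTop S :=
  (((tendstoUniformlyOn_finsetSum _ fun i => h.comp_one (gradAt i) _).smul_of_bounded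
      (abs_neg_inv_sq_le hC)).add
    ((tendstoUniformlyOn_finsetSum _ fun i =>
      h.comp_two ((gradAt i).comp (flipApply (0, 1))) _).smul_of_bounded hC)).add
    ((tendstoUniformlyOn_finsetSum _ fun _ => (tendstoUniformlyOn_finsetSum _ fun i =>
      h.comp_one (gradAt i) _).smul_of_bounded hC).smul_of_bounded hC)

end JetTendsto

end UniformConvergence

/-! ### Spatial derivatives of `lift (kd Ψ x)` and `lift (kd (kd Ψ x) y)` -/

section SpatialDerivatives

variable {N : ℕ} {k : ℝ} {μ : Md d} {Ψ : Ph d r → ℝ}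

lemma mass_pos (hk : 0 < k) (hμ : μ ∈ HNk d N k) : 0 < (μ.mass : ℝ) :=
  (one_div_pos.2 hk).trans_le hμ.2.1

variable (hk : 0 < k) (hμ : μ ∈ HNk d N k) (hΨ : ContDiff ℝ 2 Ψ)

include hk hμ hΨ

lemma lift_kd_kd (x y : Eu d) : lift (kd (kd Ψ x) y) μ = lift (kdTwo Ψ x y) μ :=
  integral_congr_ae (Eventually.of_forall fun _ => kd_kd hΨ x y (mass_pos hk hμ).ne')

lemma gradient_lift_kd :
    gradient (fun x => lift (kd Ψ x) μ) = fun x => lift (gradKd Ψ x) μ := by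
  have hm := (mass_pos hk hμ).ne'
  refine funext fun x => (hasGradientAt_lift hμ (fun x => ?_) ?_
    (fun x w => hasGradientAt_kd hΨ _ x) x).gradient
  · exact continuous_kd hΨ continuous_const (by fun_prop) fun _ => hm
  · exact continuous_gradKd hΨ continuous_fst (by fun_prop) fun _ => hm

lemma fderiv_gradient_lift_kd (x : Eu d) :
    fderiv ℝ (gradient fun x => lift (kd Ψ x) μ) x = lift (jacKd Ψ x) μ := by
  have hm := (mass_pos hk hμ).ne'
  rw [gradient_lift_kd hk hμ hΨ]
  refine (hasFDerivAt_lift hμ (fun x => ?_) ?_ (fun x w => hasFDerivAt_gradKd hΨ _ x) x).fderiv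
  · exact continuous_gradKd hΨ continuous_const (by fun_prop) fun _ => hm
  · exact continuous_jacKd hΨ continuous_fst (by fun_prop) fun _ => hm

lemma gradient_lift_kd_kd (x y : Eu d) :
    gradient (fun x => lift (kd (kd Ψ x) y) μ) x = lift (gradKdTwo Ψ x y) μ := by
  have hm := (mass_pos hk hμ).ne'
  simp only [lift_kd_kd hk hμ hΨ]
  refine (hasGradientAt_lift hμ (a := fun x => kdTwo Ψ x y) (g := fun x => gradKdTwo Ψ x y)
    (fun x => ?_) ?_ (fun x w => hasGradientAt_kdTwo hΨ y _ x) x).gradient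
  · exact continuous_kdTwo hΨ continuous_const continuous_const (by fun_prop) fun _ => hm
  · exact continuous_gradKdTwo hΨ continuous_fst continuous_const (by fun_prop) fun _ => hm

lemma fderiv_gradient_lift_kd_kd (x y : Eu d) :
    fderiv ℝ (fun y => gradient (fun x => lift (kd (kd Ψ x) y) μ) x) y =
      lift (jacKdTwo Ψ x y) μ := by
  have hm := (mass_pos hk hμ).ne'
  simp only [gradient_lift_kd_kd hk hμ hΨ]
  refine (hasFDerivAt_lift hμ (a := gradKdTwo Ψ x) (a' := jacKdTwo Ψ x) (fun y => ?_) ?_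
    (fun y w => hasFDerivAt_gradKdTwo hΨ x _ y) y).fderiv
  · exact continuous_gradKdTwo hΨ continuous_const continuous_const (by fun_prop) fun _ => hm
  · exact continuous_jacKdTwo hΨ continuous_const continuous_fst (by fun_prop) fun _ => hm

end SpatialDerivatives

/-! ### The kernel of `f` -/

lemma exists_cutoff {N : ℕ} {k : ℝ} (hk : 1 < k) {φ : (Fin r → Eu d) → ℝ → ℝ}
    (hφ : ContDiff ℝ 2 (fun p : (Fin r → Eu d) × ℝ => φ p.1 p.2)) :
    ∃ Φ : Ph d r → ℝ, ContDiff ℝ 2 Φ ∧ HasCompactSupport Φ ∧ (∀ p ∈ tsupport Φ, 0 < p.2) ∧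
      ∀ p ∈ phaseBox d r N k, Φ p = (p.2 ^ r)⁻¹ * φ p.1 p.2 := by
  have hk0 : 0 < 1 / k := by positivity
  have hk1 : 1 / k < k := ((div_lt_one (by positivity)).2 hk).trans hk
  obtain ⟨R, hR⟩ := (isCompact_pi_KN (d := d) (r := r) (N := N)).isBounded.subset_closedBall 0
  let χ₁ : ContDiffBump (0 : Fin r → Eu d) :=
    ⟨max R 1, max R 1 + 1, by positivity, lt_add_one _⟩
  let χ₂ : ContDiffBump ((k + 1 / k) / 2) :=
    ⟨(k - 1 / k) / 2, k / 2, by linarith, by linarith⟩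
  let Φ : Ph d r → ℝ := fun p => χ₁ p.1 * χ₂ p.2 * ((p.2 ^ r)⁻¹ * φ p.1 p.2)
  have hsupp : tsupport Φ ⊆ Metric.closedBall 0 (max R 1 + 1) ×ˢ
      Metric.closedBall ((k + 1 / k) / 2) (k / 2) := by
    refine closure_minimal (fun p hp => ?_)
      (Metric.isClosed_closedBall.prod Metric.isClosed_closedBall)
    have h := left_ne_zero_of_mul hp
    have h1 : p.1 ∈ Function.support χ₁ := left_ne_zero_of_mul h
    have h2 : p.2 ∈ Function.support χ₂ := right_ne_zero_of_mul h
    rw [ContDiffBump.support_eq] at h1 h2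
    exact ⟨Metric.ball_subset_closedBall h1, Metric.ball_subset_closedBall h2⟩
  have hpos : ∀ p ∈ tsupport Φ, 0 < p.2 := fun p hp => by
    have h := (hsupp hp).2
    rw [Real.closedBall_eq_Icc] at h
    linarith [h.1]
  refine ⟨Φ, contDiff_iff_contDiffAt.2 fun p => ?_,
    HasCompactSupport.of_support_subset_isCompact
      ((isCompact_closedBall _ _).prod (isCompact_closedBall _ _))
      ((subset_tsupport Φ).trans hsupp), hpos, fun p hp => ?_⟩
  · by_cases hp : p ∈ tsupport Φ
    · have h1 : ContDiffAt ℝ 2 (fun p : Ph d r => (p.2 ^ r)⁻¹) p :=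
        (contDiffAt_snd.pow r).inv (pow_ne_zero r (hpos p hp).ne')
      have h2 : ContDiffAt ℝ 2 (fun p : Ph d r => χ₁ p.1) p :=
        χ₁.contDiff.contDiffAt.comp p contDiffAt_fst
      have h3 : ContDiffAt ℝ 2 (fun p : Ph d r => χ₂ p.2) p :=
        χ₂.contDiff.contDiffAt.comp p contDiffAt_snd
      exact (h2.mul h3).mul (h1.mul hφ.contDiffAt)
    · exact contDiffAt_const.congr_of_eventuallyEq (notMem_tsupport_iff_eventuallyEq.1 hp)
  · have h1 : χ₁ p.1 = 1 := χ₁.one_of_mem_closedBall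
      (Metric.closedBall_subset_closedBall (le_max_left _ _) (hR hp.1))
    have h2 : χ₂ p.2 = 1 := χ₂.one_of_mem_closedBall (by
      have hr : χ₂.rIn = (k - 1 / k) / 2 := rfl
      rw [Real.closedBall_eq_Icc, hr]
      exact ⟨by linarith [hp.2.1], by linarith [hp.2.2]⟩)
    simp only [Φ, h1, h2, one_mul]

lemma abs_inv_le_of_mem_phaseBox {N : ℕ} {k : ℝ} (hk : 0 < k) {p : Ph d r}
    (hp : p ∈ phaseBox d r N k) : |p.2⁻¹| ≤ k := by
  have h : 0 < p.2 := (one_div_pos.2 hk).trans_le hp.2.1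
  rw [abs_of_pos (inv_pos.2 h)]
  exact inv_le_of_inv_le₀ hk (by simpa using hp.2.1)

/-! ### Uniform convergence of the derivatives -/

section UniformConvergence

variable {N : ℕ} {k : ℝ} {Ψ : ℕ → Ph d r → ℝ} {Φ : Ph d r → ℝ} (hk : 0 < k)
  (hJ : JetTendsto Ψ Φ) (hΨ : ∀ n, ContDiff ℝ 2 (Ψ n)) (hΦ : ContDiff ℝ 2 Φ)

include hJ hΨ hΦ

lemma tendstoUniformlyOn_lift_self :
    TendstoUniformlyOn (fun n μ => lift (Ψ n) μ) (lift Φ) atTop (HNk d N k) := by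
  have h : TendstoUniformlyOn (fun n (q : Md d × Unit) => lift (Ψ n) q.1)
      (fun q => lift Φ q.1) atTop (HNk d N k ×ˢ univ) :=
    tendstoUniformlyOn_lift (A := fun n _ => Ψ n) (A' := fun _ => Φ)
      (fun n _ μ _ => (hΨ n).continuous.comp (by fun_prop))
      (fun _ μ _ => hΦ.continuous.comp (by fun_prop)) (hJ.comp_zero _)
  exact (h.comp fun μ => (μ, ())).mono fun μ hμ => ⟨hμ, mem_univ _⟩

include hk

lemma tendstoUniformlyOn_lift_kd :
    TendstoUniformlyOn (fun n (q : Md d × Eu d) => lift (kd (Ψ n) q.2) q.1)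
      (fun q => lift (kd Φ q.2) q.1) atTop (HNk d N k ×ˢ KN d N) := by
  have h : TendstoUniformlyOn (fun n (q : Md d × Eu d) => lift (kd (Ψ n) q.2) q.1)
      (fun q => lift (kd Φ q.2) q.1) atTop (HNk d N k ×ˢ KN d N) :=
    tendstoUniformlyOn_lift
      (fun n _ μ hμ => continuous_kd (hΨ n) continuous_const (by fun_prop)
        fun _ => (mass_pos hk hμ).ne')
      (fun _ μ hμ => continuous_kd hΦ continuous_const (by fun_prop)
        fun _ => (mass_pos hk hμ).ne')
      (hJ.kd fun a ha => abs_inv_le_of_mem_phaseBox hk ha.2)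
  exact h

lemma tendstoUniformlyOn_gradient_lift_kd :
    TendstoUniformlyOn (fun n (q : Md d × Eu d) => gradient (fun x => lift (kd (Ψ n) x) q.1) q.2)
      (fun q => gradient (fun x => lift (kd Φ x) q.1) q.2) atTop (HNk d N k ×ˢ KN d N) := by
  have h : TendstoUniformlyOn (fun n (q : Md d × Eu d) => lift (gradKd (Ψ n) q.2) q.1)
      (fun q => lift (gradKd Φ q.2) q.1) atTop (HNk d N k ×ˢ KN d N) :=
    tendstoUniformlyOn_lift
      (fun n _ μ hμ => continuous_gradKd (hΨ n) continuous_const (by fun_prop)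
        fun _ => (mass_pos hk hμ).ne')
      (fun _ μ hμ => continuous_gradKd hΦ continuous_const (by fun_prop)
        fun _ => (mass_pos hk hμ).ne')
      (hJ.gradKd fun a ha => abs_inv_le_of_mem_phaseBox hk ha.2)
  exact (h.congr (Eventually.of_forall fun n q hq =>
    (congrFun (gradient_lift_kd hk hq.1 (hΨ n)) q.2).symm)).congr_right fun q hq => (congrFun (gradient_lift_kd hk hq.1 hΦ) q.2).symm

lemma tendstoUniformlyOn_fderiv_gradient_lift_kd :
    TendstoUniformlyOn (fun n (q : Md d × Eu d) => fderiv ℝ (gradient fun x => lift (kd (Ψ n) x) q.1) q.2)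
      (fun q => fderiv ℝ (gradient fun x => lift (kd Φ x) q.1) q.2) atTop (HNk d N k ×ˢ KN d N) := by
  have h : TendstoUniformlyOn (fun n (q : Md d × Eu d) => lift (jacKd (Ψ n) q.2) q.1)
      (fun q => lift (jacKd Φ q.2) q.1) atTop (HNk d N k ×ˢ KN d N) :=
    tendstoUniformlyOn_lift
      (fun n _ μ hμ => continuous_jacKd (hΨ n) continuous_const (by fun_prop)
        fun _ => (mass_pos hk hμ).ne')
      (fun _ μ hμ => continuous_jacKd hΦ continuous_const (by fun_prop)
        fun _ => (mass_pos hk hμ).ne')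
      (hJ.jacKd fun a ha => abs_inv_le_of_mem_phaseBox hk ha.2)
  exact (h.congr (Eventually.of_forall fun n q hq =>
    (fderiv_gradient_lift_kd hk hq.1 (hΨ n) q.2).symm)).congr_right fun q hq => (fderiv_gradient_lift_kd hk hq.1 hΦ q.2).symm

lemma tendstoUniformlyOn_lift_kd_kd :
    TendstoUniformlyOn
      (fun n (q : Md d × Eu d × Eu d) => lift (kd (kd (Ψ n) q.2.1) q.2.2) q.1)
      (fun q => lift (kd (kd Φ q.2.1) q.2.2) q.1) atTop
      (HNk d N k ×ˢ KN d N ×ˢ KN d N) := by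
  have h : TendstoUniformlyOn
      (fun n (q : Md d × Eu d × Eu d) => lift (kdTwo (Ψ n) q.2.1 q.2.2) q.1)
      (fun q => lift (kdTwo Φ q.2.1 q.2.2) q.1) atTop (HNk d N k ×ˢ KN d N ×ˢ KN d N) :=
    tendstoUniformlyOn_lift (Q := Eu d × Eu d) (T := KN d N ×ˢ KN d N)
      (A := fun n q => kdTwo (Ψ n) q.1 q.2) (A' := fun q => kdTwo Φ q.1 q.2)
      (fun n _ μ hμ => continuous_kdTwo (hΨ n) continuous_const continuous_const (by fun_prop)
        fun _ => (mass_pos hk hμ).ne')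
      (fun _ μ hμ => continuous_kdTwo hΦ continuous_const continuous_const (by fun_prop)
        fun _ => (mass_pos hk hμ).ne')
      (hJ.kdTwo (S := (KN d N ×ˢ KN d N) ×ˢ phaseBox d r N k)
        (x := fun a => a.1.1) (y := fun a => a.1.2) (p := fun a => a.2) fun a ha =>
          abs_inv_le_of_mem_phaseBox hk ha.2)
  exact (h.congr (Eventually.of_forall fun n q hq =>
    (lift_kd_kd hk hq.1 (hΨ n) q.2.1 q.2.2).symm)).congr_right fun q hq =>
      (lift_kd_kd hk hq.1 hΦ q.2.1 q.2.2).symm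

lemma tendstoUniformlyOn_gradient_lift_kd_kd :
    TendstoUniformlyOn
      (fun n (q : Md d × Eu d × Eu d) => gradient (fun x => lift (kd (kd (Ψ n) x) q.2.2) q.1) q.2.1)
      (fun q => gradient (fun x => lift (kd (kd Φ x) q.2.2) q.1) q.2.1) atTop
      (HNk d N k ×ˢ KN d N ×ˢ KN d N) := by
  have h : TendstoUniformlyOn
      (fun n (q : Md d × Eu d × Eu d) => lift (gradKdTwo (Ψ n) q.2.1 q.2.2) q.1)
      (fun q => lift (gradKdTwo Φ q.2.1 q.2.2) q.1) atTop (HNk d N k ×ˢ KN d N ×ˢ KN d N) :=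
    tendstoUniformlyOn_lift (Q := Eu d × Eu d) (T := KN d N ×ˢ KN d N)
      (A := fun n q => gradKdTwo (Ψ n) q.1 q.2) (A' := fun q => gradKdTwo Φ q.1 q.2)
      (fun n _ μ hμ => continuous_gradKdTwo (hΨ n) continuous_const continuous_const (by fun_prop)
        fun _ => (mass_pos hk hμ).ne')
      (fun _ μ hμ => continuous_gradKdTwo hΦ continuous_const continuous_const (by fun_prop)
        fun _ => (mass_pos hk hμ).ne')
      (hJ.gradKdTwo (S := (KN d N ×ˢ KN d N) ×ˢ phaseBox d r N k)
        (x := fun a => a.1.1) (y := fun a => a.1.2) (p := fun a => a.2) fun a ha =>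
          abs_inv_le_of_mem_phaseBox hk ha.2)
  exact (h.congr (Eventually.of_forall fun n q hq =>
    (gradient_lift_kd_kd hk hq.1 (hΨ n) q.2.1 q.2.2).symm)).congr_right fun q hq =>
      (gradient_lift_kd_kd hk hq.1 hΦ q.2.1 q.2.2).symm

lemma tendstoUniformlyOn_fderiv_gradient_lift_kd_kd :
    TendstoUniformlyOn
      (fun n (q : Md d × Eu d × Eu d) =>
        fderiv ℝ (fun y => gradient (fun x => lift (kd (kd (Ψ n) x) y) q.1) q.2.1) q.2.2)
      (fun q => fderiv ℝ (fun y => gradient (fun x => lift (kd (kd Φ x) y) q.1) q.2.1) q.2.2) atTop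
      (HNk d N k ×ˢ KN d N ×ˢ KN d N) := by
  have h : TendstoUniformlyOn
      (fun n (q : Md d × Eu d × Eu d) => lift (jacKdTwo (Ψ n) q.2.1 q.2.2) q.1)
      (fun q => lift (jacKdTwo Φ q.2.1 q.2.2) q.1) atTop (HNk d N k ×ˢ KN d N ×ˢ KN d N) :=
    tendstoUniformlyOn_lift (Q := Eu d × Eu d) (T := KN d N ×ˢ KN d N)
      (A := fun n q => jacKdTwo (Ψ n) q.1 q.2) (A' := fun q => jacKdTwo Φ q.1 q.2)
      (fun n _ μ hμ => continuous_jacKdTwo (hΨ n) continuous_const continuous_const (by fun_prop)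
        fun _ => (mass_pos hk hμ).ne')
      (fun _ μ hμ => continuous_jacKdTwo hΦ continuous_const continuous_const (by fun_prop)
        fun _ => (mass_pos hk hμ).ne')
      (hJ.jacKdTwo (S := (KN d N ×ˢ KN d N) ×ˢ phaseBox d r N k)
        (x := fun a => a.1.1) (y := fun a => a.1.2) (p := fun a => a.2) fun a ha =>
          abs_inv_le_of_mem_phaseBox hk ha.2)
  exact (h.congr (Eventually.of_forall fun n q hq =>
    (fderiv_gradient_lift_kd_kd hk hq.1 (hΨ n) q.2.1 q.2.2).symm)).congr_right fun q hq =>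
      (fderiv_gradient_lift_kd_kd hk hq.1 hΦ q.2.1 q.2.2).symm

end UniformConvergence

/-- approximation by cylindrical functions in the `C²_L(H_N^k)` norm.
Fix `N ≥ 1`, `k > 1`, `r ∈ ℕ`, let `H = H_N^k`, `K = K_N`, let
`φ ∈ C²_b(K_Nʳ × [1/k,k])` be symmetric in its first `r` arguments, and set
`f(μ) = μ(ℝ^d)^{−r} ∫ φ(x₁,…,x_r,μ(ℝ^d)) dμ^{⊗r}`. Then there is a sequence `fⁿ` of
cylindrical functions of order 2 converging to `f` uniformly on `H`, whose first- and
second-order linear functional derivatives converge uniformly (on `H × K`, resp.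
`H × K × K`) to linear functional derivatives `δf`, `δ²f` of `f`, and whose
L-derivatives `D_μfⁿ`, spatial Jacobians `D_x D_μfⁿ`, spatial gradients `D_x δ²fⁿ` and
second-order L-derivatives `D²_μfⁿ` converge uniformly to those of `f`. -/
theorem stmt17 (N : ℕ) (hN : 1 ≤ N) (k : ℝ) (hk : 1 < k) (r : ℕ)
    (φ : (Fin r → Eu d) → ℝ → ℝ)
    (hφ : ContDiff ℝ 2 (fun p : (Fin r → Eu d) × ℝ => φ p.1 p.2))
    (hφsym : ∀ (σ : Equiv.Perm (Fin r)) (x : Fin r → Eu d) (z : ℝ), φ (x ∘ σ) z = φ x z)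
    (f : Md d → ℝ)
    (hf : f = fun (μ : Md d) => (((μ.mass : ℝ)) ^ r)⁻¹ *
      ∫ x : Fin r → Eu d, φ x (μ.mass : ℝ)
        ∂(Measure.pi fun _ : Fin r => (μ : Measure (Eu d)))) :
    ∃ (F : ℕ → Md d → ℝ) (δF : ℕ → Md d → Eu d → ℝ)
      (δ2F : ℕ → Md d → Eu d → Eu d → ℝ)
      (δf : Md d → Eu d → ℝ) (δ2f : Md d → Eu d → Eu d → ℝ),
      (∀ n, IsCylindrical2 (F n)) ∧
      (∀ n, IsLFD (F n) (δF n)) ∧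
      (∀ (n : ℕ) (x : Eu d), IsLFD (fun μ => δF n μ x) (fun μ y => δ2F n μ x y)) ∧
      IsLFDOn f δf (HNk d N k) (KN d N) ∧
      (∀ x ∈ KN d N,
        IsLFDOn (fun μ => δf μ x) (fun μ y => δ2f μ x y) (HNk d N k) (KN d N)) ∧
      -- uniform convergence of the functions on `H`
      TendstoUniformlyOn (fun n μ => F n μ) f Filter.atTop (HNk d N k) ∧
      -- uniform convergence of the first-order linear functional derivatives on `H × K`
      TendstoUniformlyOn (fun n (p : Md d × Eu d) => δF n p.1 p.2)
        (fun p => δf p.1 p.2) Filter.atTop (HNk d N k ×ˢ KN d N) ∧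
      -- uniform convergence of the second-order linear functional derivatives
      TendstoUniformlyOn (fun n (p : Md d × Eu d × Eu d) => δ2F n p.1 p.2.1 p.2.2)
        (fun p => δ2f p.1 p.2.1 p.2.2) Filter.atTop
        (HNk d N k ×ˢ KN d N ×ˢ KN d N) ∧
      -- uniform convergence of the L-derivatives `D_μfⁿ = ∇ₓδfⁿ`
      TendstoUniformlyOn (fun n (p : Md d × Eu d) => gradient (δF n p.1) p.2)
        (fun p => gradient (δf p.1) p.2) Filter.atTop (HNk d N k ×ˢ KN d N) ∧
      -- uniform convergence of the spatial Jacobians `D_x D_μfⁿ`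
      TendstoUniformlyOn (fun n (p : Md d × Eu d) => fderiv ℝ (gradient (δF n p.1)) p.2)
        (fun p => fderiv ℝ (gradient (δf p.1)) p.2) Filter.atTop
        (HNk d N k ×ˢ KN d N) ∧
      -- uniform convergence of the spatial gradients `D_x δ²fⁿ` of the second-order
      -- linear functional derivatives
      TendstoUniformlyOn
        (fun n (p : Md d × Eu d × Eu d) =>
          gradient (fun x => δ2F n p.1 x p.2.2) p.2.1)
        (fun p => gradient (fun x => δ2f p.1 x p.2.2) p.2.1) Filter.atTop
        (HNk d N k ×ˢ KN d N ×ˢ KN d N) ∧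
      -- uniform convergence of the second-order L-derivatives `D²_μfⁿ = ∇ₓ∇_yᵀδ²fⁿ`
      TendstoUniformlyOn
        (fun n (p : Md d × Eu d × Eu d) =>
          fderiv ℝ (fun y => gradient (fun x => δ2F n p.1 x y) p.2.1) p.2.2)
        (fun p => fderiv ℝ (fun y => gradient (fun x => δ2f p.1 x y) p.2.1) p.2.2)
        Filter.atTop (HNk d N k ×ˢ KN d N ×ˢ KN d N) := by
  have hk0 : 0 < k := one_pos.trans hk
  obtain ⟨Φ, hΦ, hΦs, hΦpos, hΦf⟩ := exists_cutoff (N := N) hk hφ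
  choose Ψ hΨ hJ using fun n : ℕ =>
    exists_mem_sepKernels_jet_approx hΦ hΦs hΦpos (Nat.one_div_pos_of_nat (α := ℝ) (n := n))
  have hΨc : ∀ n, ContDiff ℝ 2 (Ψ n) := fun n => contDiff_of_mem_sepKernels (hΨ n)
  have hfΦ : ∀ μ ∈ HNk d N k, lift Φ μ = f μ := fun μ hμ => by
    subst hf
    beta_reduce
    rw [← integral_const_mul]
    refine integral_congr_ae ?_
    filter_upwards [ae_pi_mem_KN hμ] with w hw using hΦf _ ⟨hw, hμ.2⟩
  have h0 : TendstoUniformlyOn (fun n μ => lift (Ψ n) μ) f atTop (HNk d N k) :=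
    (tendstoUniformlyOn_lift_self hJ hΨc hΦ).congr_right hfΦ
  have h1 := tendstoUniformlyOn_lift_kd (N := N) hk0 hJ hΨc hΦ
  have h2 := tendstoUniformlyOn_lift_kd_kd (N := N) hk0 hJ hΨc hΦ
  have hF := fun n => isLFD_lift (hΨ n)
  have hδF := fun n x => isLFD_lift (kd_mem_sepKernels (hΨ n) x)
  exact ⟨fun n => lift (Ψ n), fun n μ x => lift (kd (Ψ n) x) μ,
    fun n μ x y => lift (kd (kd (Ψ n) x) y) μ, fun μ x => lift (kd Φ x) μ,
    fun μ x y => lift (kd (kd Φ x) y) μ, fun n => isCylindrical2_lift (hΨ n), hF, hδF,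
    isLFDOn_of_tendstoUniformlyOn hF (fun μ hμ => h0.tendsto_at hμ) h1, fun x hx =>
      isLFDOn_of_tendstoUniformlyOn (fun n => hδF n x)
        (fun μ hμ => h1.tendsto_at (x := (μ, x)) ⟨hμ, hx⟩)
        ((h2.comp fun q : Md d × Eu d => (q.1, x, q.2)).mono fun q hq => ⟨hq.1, hx, hq.2⟩),
    h0, h1, h2, tendstoUniformlyOn_gradient_lift_kd hk0 hJ hΨc hΦ,
    tendstoUniformlyOn_fderiv_gradient_lift_kd hk0 hJ hΨc hΦ,
    tendstoUniformlyOn_gradient_lift_kd_kd hk0 hJ hΨc hΦ,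
    tendstoUniformlyOn_fderiv_gradient_lift_kd_kd hk0 hJ hΨc hΦ⟩

end
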